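/- arXiv:2001.00799 — 2 statements merged into one kernel-verified Lean document; each statement's English description precedes it below -/
import Mathlib

section
/- If ρ_{AB₁B₂} = ρ_{AB₁} ⊗ ρ_{B₂} is a product state between AB₁ and B₂, then the tripartite uncertainty bound is saturated: S(R|AB₁)_κ + S(A|B₂)_ω = S(R)_κ + D(κ_{AB₁} ‖ ω_{AB₁}) + max{0, I(A:B₁)_ω − I(B₁:B₂)_ρ + S(A|B₁B₂)_ρ}. -/
open scoped Kronecker Classical ComplexOrder
open Matrix

noncomputable section

/-- The rank-one projector `|v⟩⟨v|`. -/
def proj {α : Type*} (v : α → ℂ) : Matrix α α ℂ := Matrix.vecMulVec v (star v)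

/-- Matrix logarithm of a Hermitian matrix, via the spectral decomposition
(junk value `0` on non-Hermitian matrices; eigenvalue `0` contributes `log 0 = 0`). -/
def mlog {n : Type*} [Fintype n] [DecidableEq n] (ρ : Matrix n n ℂ) : Matrix n n ℂ :=
  if h : ρ.IsHermitian then
    (h.eigenvectorUnitary : Matrix n n ℂ) *
      Matrix.diagonal (fun i => (Real.log (h.eigenvalues i) : ℂ)) *
      (h.eigenvectorUnitary : Matrix n n ℂ)ᴴ
  else 0

/-- Von Neumann entropy `S(ρ) = -Tr ρ log ρ`. -/
def vN {n : Type*} [Fintype n] [DecidableEq n] (ρ : Matrix n n ℂ) : ℝ :=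
  -(Matrix.trace (ρ * mlog ρ)).re

/-- Quantum relative entropy `D(ρ‖σ) = Tr ρ (log ρ - log σ)`. -/
def relent {n : Type*} [Fintype n] [DecidableEq n] (ρ σ : Matrix n n ℂ) : ℝ :=
  (Matrix.trace (ρ * (mlog ρ - mlog σ))).re

/-- The rotation `e^{-iGr}` generated by the Hermitian operator `G` with orthonormal
eigenbasis `g` and eigenvalues `gv`. -/
def Urot {iA : Type*} [Fintype iA] (g : iA → iA → ℂ) (gv : iA → ℝ) (r : ℝ) : Matrix iA iA ℂ :=
  ∑ l, Complex.exp (-(Complex.I) * (gv l) * r) • proj (g l)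

section Tripartite

variable {iR iA iB1 iB2 : Type*} [Fintype iR] [Fintype iA] [Fintype iB1] [Fintype iB2]
  [DecidableEq iR] [DecidableEq iA] [DecidableEq iB1] [DecidableEq iB2]

/-- `e^{-iGr} ⊗ I_{B₁} ⊗ I_{B₂}`. -/
def UA3
    (g : iA → iA → ℂ) (gv : iA → ℝ) (r : ℝ) :
    Matrix ((iA × iB1) × iB2) ((iA × iB1) × iB2) ℂ :=
  (Urot g gv r ⊗ₖ (1 : Matrix iB1 iB1 ℂ)) ⊗ₖ (1 : Matrix iB2 iB2 ℂ)

/-- `κ_{RAB₁B₂} = Σ_k p_k |r_k⟩⟨r_k| ⊗ (e^{-iGr_k}⊗I) ρ (e^{iGr_k}⊗I)`. -/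
def kappa3
    (p : iR → ℝ) (rb : iR → iR → ℂ) (rv : iR → ℝ) (g : iA → iA → ℂ) (gv : iA → ℝ)
    (ρ : Matrix ((iA × iB1) × iB2) ((iA × iB1) × iB2) ℂ) :
    Matrix (iR × ((iA × iB1) × iB2)) (iR × ((iA × iB1) × iB2)) ℂ :=
  ∑ k, (p k : ℂ) • (proj (rb k) ⊗ₖ (UA3 g gv (rv k) * ρ * (UA3 g gv (rv k))ᴴ))

/-- `ω_{AB₁B₂} = Σ_l (|g_l⟩⟨g_l|⊗I) ρ (|g_l⟩⟨g_l|⊗I)`. -/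
def omega3 
    (g : iA → iA → ℂ)
    (ρ : Matrix ((iA × iB1) × iB2) ((iA × iB1) × iB2) ℂ) :
    Matrix ((iA × iB1) × iB2) ((iA × iB1) × iB2) ℂ :=
  ∑ l, ((proj (g l) ⊗ₖ (1 : Matrix iB1 iB1 ℂ)) ⊗ₖ (1 : Matrix iB2 iB2 ℂ)) * ρ *
       ((proj (g l) ⊗ₖ (1 : Matrix iB1 iB1 ℂ)) ⊗ₖ (1 : Matrix iB2 iB2 ℂ))

/-- Reduced state on `RAB₁` of a state on `RAB₁B₂`. -/
def redRAB1 
    (τ : Matrix (iR × ((iA × iB1) × iB2)) (iR × ((iA × iB1) × iB2)) ℂ) :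
    Matrix (iR × (iA × iB1)) (iR × (iA × iB1)) ℂ :=
  Matrix.of fun x y => ∑ k : iB2, τ (x.1, (x.2, k)) (y.1, (y.2, k))

/-- Reduced state on `AB₁` of a state on `RAB₁B₂`. -/
def redAB1four 
    (τ : Matrix (iR × ((iA × iB1) × iB2)) (iR × ((iA × iB1) × iB2)) ℂ) :
    Matrix (iA × iB1) (iA × iB1) ℂ :=
  Matrix.of fun x y => ∑ k : iR, ∑ m : iB2, τ (k, (x, m)) (k, (y, m))

/-- Reduced state on `R` of a state on `RAB₁B₂`. -/
def redRfour 
    (τ : Matrix (iR × ((iA × iB1) × iB2)) (iR × ((iA × iB1) × iB2)) ℂ) :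
    Matrix iR iR ℂ :=
  Matrix.of fun i j => ∑ x : (iA × iB1) × iB2, τ (i, x) (j, x)

/-- Reduced state on `AB₁` of a state on `AB₁B₂`. -/
def redAB1 
    (σ : Matrix ((iA × iB1) × iB2) ((iA × iB1) × iB2) ℂ) :
    Matrix (iA × iB1) (iA × iB1) ℂ :=
  Matrix.of fun x y => ∑ k : iB2, σ (x, k) (y, k)

/-- Reduced state on `AB₂` of a state on `AB₁B₂`. -/
def redAB2 
    (σ : Matrix ((iA × iB1) × iB2) ((iA × iB1) × iB2) ℂ) :
    Matrix (iA × iB2) (iA × iB2) ℂ :=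
  Matrix.of fun x y => ∑ m : iB1, σ ((x.1, m), x.2) ((y.1, m), y.2)

/-- Reduced state on `B₂` of a state on `AB₁B₂`. -/
def redB2 
    (σ : Matrix ((iA × iB1) × iB2) ((iA × iB1) × iB2) ℂ) :
    Matrix iB2 iB2 ℂ :=
  Matrix.of fun i j => ∑ x : iA × iB1, σ (x, i) (x, j)

/-- Reduced state on `A` of a state on `AB₁B₂`. -/
def redA3 
    (σ : Matrix ((iA × iB1) × iB2) ((iA × iB1) × iB2) ℂ) :
    Matrix iA iA ℂ :=
  Matrix.of fun i j => ∑ m : iB1, ∑ k : iB2, σ ((i, m), k) ((j, m), k)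

/-- Reduced state on `B₁` of a state on `AB₁B₂`. -/
def redB1 
    (σ : Matrix ((iA × iB1) × iB2) ((iA × iB1) × iB2) ℂ) :
    Matrix iB1 iB1 ℂ :=
  Matrix.of fun i j => ∑ a : iA, ∑ k : iB2, σ ((a, i), k) ((a, j), k)

/-- Reduced state on `B₁B₂` of a state on `AB₁B₂`. -/
def redB1B2 
    (σ : Matrix ((iA × iB1) × iB2) ((iA × iB1) × iB2) ℂ) :
    Matrix (iB1 × iB2) (iB1 × iB2) ℂ :=
  Matrix.of fun x y => ∑ a : iA, σ ((a, x.1), x.2) ((a, y.1), y.2)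

end Tripartite


lemma herm_spec {n : Type*} [Fintype n] [DecidableEq n] {ρ : Matrix n n ℂ} (h : ρ.IsHermitian) :
    ∃ (U : Matrix n n ℂ) (e : n → ℝ), Uᴴ * U = 1 ∧ U * Uᴴ = 1 ∧
      ρ = U * diagonal (fun i => (e i : ℂ)) * Uᴴ ∧
      mlog ρ = U * diagonal (fun i => (Real.log (e i) : ℂ)) * Uᴴ ∧
      (ρ.PosSemidef → ∀ i, 0 ≤ e i) ∧ ρ.trace = ∑ i, (e i : ℂ) := by
  refine ⟨h.eigenvectorUnitary, h.eigenvalues, ?_, ?_, ?_, ?_, ?_, ?_⟩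
  · rw [← star_eq_conjTranspose]; exact Unitary.coe_star_mul_self _
  · rw [← star_eq_conjTranspose]; exact Unitary.coe_mul_star_self _
  · conv_lhs => rw [h.spectral_theorem]
    rw [Unitary.conjStarAlgAut_apply]; rfl
  · simp [mlog, h]
  · intro hp i; exact hp.eigenvalues_nonneg i
  · exact h.trace_eq_sum_eigenvalues

/-- Functional calculus on an isometric decomposition. -/
lemma mlog_iso {n m : Type*} [Fintype n] [DecidableEq n] [Fintype m] [DecidableEq m]
    (V : Matrix n m ℂ) (d : m → ℝ) (hV : Vᴴ * V = 1) :
    mlog (V * diagonal (fun i => (d i : ℂ)) * Vᴴ)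
      = V * diagonal (fun i => (Real.log (d i) : ℂ)) * Vᴴ := by
  set ρ := V * diagonal (fun i => (d i : ℂ)) * Vᴴ with hρ
  have h : ρ.IsHermitian := by
    rw [IsHermitian, hρ, conjTranspose_mul, conjTranspose_mul, conjTranspose_conjTranspose,
      diagonal_conjTranspose, Matrix.mul_assoc]
    congr 3
    ext i; simp
  obtain ⟨U, e, hU, hU', hs, hl, -, -⟩ := herm_spec h
  rw [hl]
  have h1 : diagonal (fun i => (Real.log (e i) : ℂ)) * (Uᴴ * V)
      = (Uᴴ * V) * diagonal (fun i => (Real.log (d i) : ℂ)) := by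
    have h0 : diagonal (fun i => (e i : ℂ)) * (Uᴴ * V)
        = (Uᴴ * V) * diagonal (fun i => (d i : ℂ)) := by
      have : Uᴴ * ρ * V = Uᴴ * ρ * V := rfl
      conv_lhs at this => rw [hs]
      conv_rhs at this => rw [hρ]
      calc _ = (Uᴴ * U) * diagonal (fun i => (e i : ℂ)) * (Uᴴ * V) := by rw [hU, Matrix.one_mul]
        _ = Uᴴ * (U * diagonal (fun i => (e i : ℂ)) * Uᴴ) * V := by simp only [Matrix.mul_assoc]
        _ = Uᴴ * (V * diagonal (fun i => (d i : ℂ)) * Vᴴ) * V := this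
        _ = (Uᴴ * V) * diagonal (fun i => (d i : ℂ)) * (Vᴴ * V) := by simp only [Matrix.mul_assoc]
        _ = _ := by rw [hV, Matrix.mul_one]
    ext i j
    have := congrFun (congrFun h0 i) j
    rw [diagonal_mul, mul_diagonal] at this ⊢
    by_cases hx : (Uᴴ * V) i j = 0
    · simp [hx]
    · have : (e i : ℂ) = d j := by
        apply mul_right_cancel₀ hx; rw [this, mul_comm]
      have : e i = d j := by exact_mod_cast this
      rw [this, mul_comm]
  have h2 : diagonal (fun i => (Real.log (e i) : ℂ)) * (Uᴴ * (1 - V * Vᴴ)) = 0 := by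
    have h0 : diagonal (fun i => (e i : ℂ)) * (Uᴴ * (1 - V * Vᴴ)) = 0 := by
      calc _ = (Uᴴ * U) * diagonal (fun i => (e i : ℂ)) * (Uᴴ * (1 - V * Vᴴ)) := by
            rw [hU, Matrix.one_mul]
        _ = Uᴴ * (U * diagonal (fun i => (e i : ℂ)) * Uᴴ) * (1 - V * Vᴴ) := by
            simp only [Matrix.mul_assoc]
        _ = Uᴴ * (V * diagonal (fun i => (d i : ℂ)) * Vᴴ) * (1 - V * Vᴴ) := by rw [← hs]
        _ = Uᴴ * V * diagonal (fun i => (d i : ℂ)) * (Vᴴ - (Vᴴ * V) * Vᴴ) := by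
            simp only [Matrix.mul_assoc, Matrix.mul_sub, Matrix.mul_one]
        _ = 0 := by rw [hV]; simp
    ext i j
    have := congrFun (congrFun h0 i) j
    rw [diagonal_mul] at this ⊢
    rcases mul_eq_zero.1 this with h | h
    · have : e i = 0 := by exact_mod_cast h
      simp [this]
    · simp [h]
  calc _ = U * (diagonal (fun i => (Real.log (e i) : ℂ)) * (Uᴴ * V)) * Vᴴ
        + U * (diagonal (fun i => (Real.log (e i) : ℂ)) * (Uᴴ * (1 - V * Vᴴ))) := by
          simp only [Matrix.mul_assoc, Matrix.mul_sub, Matrix.mul_one]; abel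
    _ = _ := by
      rw [h1, h2, Matrix.mul_zero, add_zero]
      calc _ = (U * Uᴴ) * V * diagonal (fun i => (Real.log (d i) : ℂ)) * Vᴴ := by
            simp only [Matrix.mul_assoc]
        _ = _ := by rw [hU', Matrix.one_mul]

lemma vN_iso {n m : Type*} [Fintype n] [DecidableEq n] [Fintype m] [DecidableEq m]
    (V : Matrix n m ℂ) (d : m → ℝ) (hV : Vᴴ * V = 1) :
    vN (V * diagonal (fun i => (d i : ℂ)) * Vᴴ) = ∑ i, Real.negMulLog (d i) := by
  rw [vN, mlog_iso V d hV]
  have : V * diagonal (fun i => (d i : ℂ)) * Vᴴ * (V * diagonal (fun i => (Real.log (d i) : ℂ)) * Vᴴ)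
      = V * diagonal (fun i => ((d i * Real.log (d i) : ℝ) : ℂ)) * Vᴴ := by
    calc _ = V * diagonal (fun i => (d i : ℂ)) * (Vᴴ * V) * diagonal (fun i => (Real.log (d i) : ℂ)) * Vᴴ := by
          simp only [Matrix.mul_assoc]
      _ = _ := by
          rw [hV, Matrix.mul_one, Matrix.mul_assoc V, diagonal_mul_diagonal]
          simp
  rw [this, trace_mul_comm, ← Matrix.mul_assoc, hV, Matrix.one_mul, trace_diagonal,
    ← Complex.ofReal_sum, Complex.ofReal_re, ← Finset.sum_neg_distrib]
  simp [Real.negMulLog]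

lemma diag_sandwich {n m : Type*} [Fintype m] [DecidableEq m]
    (V : Matrix n m ℂ) (d : m → ℂ) (i j : n) :
    (V * diagonal d * Vᴴ) i j = ∑ k, d k * (V i k * star (V j k)) := by
  rw [Matrix.mul_apply]
  refine Finset.sum_congr rfl fun k _ => ?_
  rw [mul_diagonal, conjTranspose_apply]; ring

lemma negMulLog_prod_sum {n m : Type*} [Fintype n] [Fintype m] (a : n → ℝ) (b : m → ℝ)
    (ha : ∑ i, a i = 1) (hb : ∑ i, b i = 1) :
    ∑ i, ∑ j, Real.negMulLog (a i * b j)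
      = ∑ i, Real.negMulLog (a i) + ∑ j, Real.negMulLog (b j) := by
  simp only [Real.negMulLog_mul, Finset.sum_add_distrib, ← Finset.sum_mul, ← Finset.mul_sum, ha, hb,
    one_mul]

lemma vN_kron {n m : Type*} [Fintype n] [DecidableEq n] [Fintype m] [DecidableEq m]
    {A : Matrix n n ℂ} {B : Matrix m m ℂ} (hA : A.IsHermitian) (hB : B.IsHermitian)
    (tA : A.trace = 1) (tB : B.trace = 1) : vN (A ⊗ₖ B) = vN A + vN B := by
  obtain ⟨U, a, hU, hU', hs, hl, -, ht⟩ := herm_spec hA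
  obtain ⟨W, b, hW, hW', hs', hl', -, ht'⟩ := herm_spec hB
  have ha : ∑ i, a i = 1 := by rw [tA] at ht; exact_mod_cast ht.symm
  have hb : ∑ i, b i = 1 := by rw [tB] at ht'; exact_mod_cast ht'.symm
  have : A ⊗ₖ B = (U ⊗ₖ W) * diagonal (fun x : n × m => ((a x.1 * b x.2 : ℝ) : ℂ)) * (U ⊗ₖ W)ᴴ := by
    conv_lhs => rw [hs, hs']
    rw [mul_kronecker_mul, mul_kronecker_mul, conjTranspose_kronecker, diagonal_kronecker_diagonal]
    simp
  rw [this, vN_iso _ _ (by rw [conjTranspose_kronecker, ← mul_kronecker_mul, hU, hW, one_kronecker_one])]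
  conv_rhs => rw [hs, hs']
  rw [vN_iso U a hU, vN_iso W b hW, Fintype.sum_prod_type, negMulLog_prod_sum a b ha hb]

lemma vN_classical {n : Type*} [Fintype n] [DecidableEq n] (g : n → n → ℂ)
    (hg : ∀ l m, star (g l) ⬝ᵥ g m = if l = m then 1 else 0) (q : n → ℝ) :
    vN (∑ l, (q l : ℂ) • proj (g l)) = ∑ l, Real.negMulLog (q l) := by
  rw [← vN_iso (Matrix.of fun a l => g l a) q]
  · congr 1
    ext i j
    rw [diag_sandwich, Matrix.sum_apply]
    simp [proj, vecMulVec_apply]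
  · ext l m
    rw [Matrix.mul_apply, one_apply, ← hg l m]
    rfl

/-- spectral decomposition of a classical-quantum operator -/
lemma cq_iso {n m : Type*} [Fintype n] [DecidableEq n] [Fintype m] [DecidableEq m] (g : n → n → ℂ)
    (hg : ∀ l m, star (g l) ⬝ᵥ g m = if l = m then 1 else 0)
    (U : n → Matrix m m ℂ) (hU : ∀ l, (U l)ᴴ * U l = 1) :
    (Matrix.of fun (x y : n × m) => g y.1 x.1 * U y.1 x.2 y.2)ᴴ *
      (Matrix.of fun (x y : n × m) => g y.1 x.1 * U y.1 x.2 y.2) = 1 := by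
  ext ⟨l, j⟩ ⟨l', j'⟩
  rw [Matrix.mul_apply, Fintype.sum_prod_type]
  have h1 := hg l l'
  rw [dotProduct] at h1
  have : ∀ x : n, ∑ y : m, (Matrix.of fun (x y : n × m) => g y.1 x.1 * U y.1 x.2 y.2)ᴴ (l, j) (x, y)
      * (Matrix.of fun (x y : n × m) => g y.1 x.1 * U y.1 x.2 y.2) (x, y) (l', j')
      = star (g l) x * g l' x * ((U l)ᴴ * U l') j j' := by
    intro x
    rw [Matrix.mul_apply, Finset.mul_sum]
    refine Finset.sum_congr rfl fun y _ => ?_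
    simp [conjTranspose_apply]; ring
  simp only [this]
  rw [← Finset.sum_mul, h1]
  by_cases h : l = l'
  · subst h
    simp [hU, one_apply]
  · simp [h, one_apply]

lemma cq_sandwich {n m : Type*} [Fintype n] [DecidableEq n] [Fintype m] [DecidableEq m] (g : n → n → ℂ)
    (U : n → Matrix m m ℂ) (e : n → m → ℝ) :
    (∑ l, proj (g l) ⊗ₖ (U l * diagonal (fun i => (e l i : ℂ)) * (U l)ᴴ)) =
    (Matrix.of fun (x y : n × m) => g y.1 x.1 * U y.1 x.2 y.2) *
      diagonal (fun y : n × m => (e y.1 y.2 : ℂ)) *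
    (Matrix.of fun (x y : n × m) => g y.1 x.1 * U y.1 x.2 y.2)ᴴ := by
  ext ⟨a, b⟩ ⟨a', b'⟩
  rw [diag_sandwich, Matrix.sum_apply, Fintype.sum_prod_type]
  refine Finset.sum_congr rfl fun l _ => ?_
  rw [kronecker_apply, diag_sandwich, Finset.mul_sum]
  refine Finset.sum_congr rfl fun j _ => ?_
  simp [proj, vecMulVec_apply]; ring

lemma vN_cq {n m : Type*} [Fintype n] [DecidableEq n] [Fintype m] [DecidableEq m] (g : n → n → ℂ)
    (hg : ∀ l m, star (g l) ⬝ᵥ g m = if l = m then 1 else 0) (τ : n → Matrix m m ℂ)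
    (hτ : ∀ l, (τ l).IsHermitian) :
    vN (∑ l, proj (g l) ⊗ₖ τ l) = ∑ l, vN (τ l) := by
  choose U e hU hU' hs hl hp ht using fun l => herm_spec (hτ l)
  have : vN (∑ l, proj (g l) ⊗ₖ τ l) = vN (∑ l, proj (g l) ⊗ₖ (U l * diagonal (fun i => (e l i : ℂ)) * (U l)ᴴ)) := by
    congr 2; funext l; rw [← hs l]
  rw [this, cq_sandwich, vN_iso _ (fun y : n × m => e y.1 y.2) (cq_iso g hg U hU), Fintype.sum_prod_type]
  refine Finset.sum_congr rfl fun l _ => ?_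
  conv_rhs => rw [hs l]
  rw [vN_iso _ _ (hU l)]

lemma mlog_cq {n m : Type*} [Fintype n] [DecidableEq n] [Fintype m] [DecidableEq m] (g : n → n → ℂ)
    (hg : ∀ l m, star (g l) ⬝ᵥ g m = if l = m then 1 else 0) (τ : n → Matrix m m ℂ)
    (hτ : ∀ l, (τ l).IsHermitian) :
    mlog (∑ l, proj (g l) ⊗ₖ τ l) = ∑ l, proj (g l) ⊗ₖ mlog (τ l) := by
  choose U e hU hU' hs hl hp ht using fun l => herm_spec (hτ l)
  have : mlog (∑ l, proj (g l) ⊗ₖ τ l) = mlog (∑ l, proj (g l) ⊗ₖ (U l * diagonal (fun i => (e l i : ℂ)) * (U l)ᴴ)) := by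
    congr 2; funext l; rw [← hs l]
  rw [this, cq_sandwich, mlog_iso _ (fun y : n × m => e y.1 y.2) (cq_iso g hg U hU)]
  simp only [hl]
  rw [← cq_sandwich g U (fun l i => Real.log (e l i))]

lemma bessel_aux {I J : Type*} [Fintype I] [Fintype J] [DecidableEq J] (X : I → J → ℂ) (r : I → ℝ)
    (e : J → ℝ) (hr : ∀ i, 0 ≤ r i) (he : ∀ j, 0 ≤ e j)
    (h2 : ∀ j j', ∑ i, (r i : ℂ) * (star (X i j) * X i j') = if j = j' then (e j : ℂ) else 0) (i : I) :
    r i * ∑ j, Complex.normSq (X i j) / e j ≤ 1 := by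
  set s := ∑ j, Complex.normSq (X i j) / e j with hs
  have hs0 : 0 ≤ s := Finset.sum_nonneg fun j _ => div_nonneg (Complex.normSq_nonneg _) (he j)
  set z : I → ℂ := fun k => ∑ j, X k j * (star (X i j) / (e j : ℂ)) with hz
  have hzi : z i = (s : ℂ) := by
    rw [hz, hs, Complex.ofReal_sum]
    refine Finset.sum_congr rfl fun j _ => ?_
    rw [Complex.ofReal_div, ← Complex.mul_conj]
    simp [mul_div_assoc]
  have hsum : ∑ k, r k * Complex.normSq (z k) = s := by
    have : ((∑ k, r k * Complex.normSq (z k) : ℝ) : ℂ) = (s : ℂ) := by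
      rw [Complex.ofReal_sum]
      calc _ = ∑ k, ∑ j, ∑ j', (star (star (X i j) / (e j : ℂ)) * (star (X i j') / (e j' : ℂ))) *
              ((r k : ℂ) * (star (X k j) * X k j')) := by
            refine Finset.sum_congr rfl fun k _ => ?_
            rw [Complex.ofReal_mul, Complex.normSq_eq_conj_mul_self, hz, map_sum, Finset.sum_mul_sum,
              Finset.mul_sum]
            refine Finset.sum_congr rfl fun j _ => ?_
            rw [Finset.mul_sum]
            refine Finset.sum_congr rfl fun j' _ => ?_
            simp; ring
        _ = ∑ j, ∑ j', (star (star (X i j) / (e j : ℂ)) * (star (X i j') / (e j' : ℂ))) *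
              ∑ k, ((r k : ℂ) * (star (X k j) * X k j')) := by
            rw [Finset.sum_comm]
            refine Finset.sum_congr rfl fun j _ => ?_
            rw [Finset.sum_comm]
            refine Finset.sum_congr rfl fun j' _ => ?_
            rw [Finset.mul_sum]
        _ = ∑ j, ((Complex.normSq (X i j) / e j : ℝ) : ℂ) := by
            refine Finset.sum_congr rfl fun j _ => ?_
            simp only [h2]
            rw [Finset.sum_eq_single j (by intro b _ hb; simp [hb.symm]) (by simp)]
            rw [Complex.ofReal_div, ← Complex.mul_conj]
            by_cases h0 : e j = 0
            · simp [h0]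
            · have : (e j : ℂ) ≠ 0 := by exact_mod_cast h0
              simp
              field_simp
        _ = _ := by rw [hs, Complex.ofReal_sum]
    exact_mod_cast this
  have hle : r i * s ^ 2 ≤ s := by
    conv_rhs => rw [← hsum]
    have := Finset.single_le_sum (f := fun k => r k * Complex.normSq (z k))
      (fun k _ => mul_nonneg (hr k) (Complex.normSq_nonneg _)) (Finset.mem_univ i)
    simp only [hzi, Complex.normSq_ofReal] at this
    rw [sq]; exact this
  rcases hs0.eq_or_lt with h | h
  · rw [← h]; simp
  · by_contra hc
    push Not at hc
    nlinarith

lemma scalar_ineq {I L J : Type*} [Fintype I] [Fintype L] [Fintype J] [DecidableEq J]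
    (X : I → L → J → ℂ) (r : I → ℝ)
    (e : L → J → ℝ) (hr : ∀ i, 0 ≤ r i) (hr1 : ∑ i, r i = 1) (he : ∀ l j, 0 ≤ e l j)
    (h1 : ∀ i, ∑ l, ∑ j, Complex.normSq (X i l j) = 1)
    (h2 : ∀ l j j', ∑ i, (r i : ℂ) * (star (X i l j) * X i l j') = if j = j' then (e l j : ℂ) else 0) :
    ∑ l, ∑ j, Real.negMulLog (e l j)
      ≤ ∑ l, Real.negMulLog (∑ j, e l j) + ∑ i, Real.negMulLog (r i) := by
  have hc : ∀ l j, ∑ i, r i * Complex.normSq (X i l j) = e l j := by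
    intro l j
    have := h2 l j j
    rw [if_pos rfl] at this
    have h : ((∑ i, r i * Complex.normSq (X i l j) : ℝ) : ℂ) = (e l j : ℂ) := by
      rw [← this, Complex.ofReal_sum]
      refine Finset.sum_congr rfl fun i _ => ?_
      rw [Complex.ofReal_mul, Complex.normSq_eq_conj_mul_self]; rfl
    exact_mod_cast h
  set q : L → ℝ := fun l => ∑ j, e l j with hq
  have hq0 : ∀ l, 0 ≤ q l := fun l => Finset.sum_nonneg fun j _ => he l j
  have swap : ∀ F : I → L → J → ℝ, ∑ i, ∑ l, ∑ j, F i l j = ∑ l, ∑ j, ∑ i, F i l j := by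
    intro F
    rw [Finset.sum_comm]
    exact Finset.sum_congr rfl fun l _ => Finset.sum_comm
  have hetot : ∑ l, q l = 1 := by
    calc ∑ l, q l = ∑ l, ∑ j, ∑ i, r i * Complex.normSq (X i l j) := by simp only [hc]; rfl
      _ = ∑ i, r i * ∑ l, ∑ j, Complex.normSq (X i l j) := by
        simp only [Finset.mul_sum]
        rw [swap]
      _ = 1 := by simp only [h1, mul_one, hr1]
  have key : ∀ i l j, r i * Complex.normSq (X i l j) *
      (Real.log (q l) + Real.log (r i) - Real.log (e l j))
      ≤ q l * r i * (r i * (Complex.normSq (X i l j) / e l j)) - r i * Complex.normSq (X i l j) := by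
    intro i l j
    have hn := Complex.normSq_nonneg (X i l j)
    by_cases h0 : r i * Complex.normSq (X i l j) = 0
    · rw [h0]
      have := mul_nonneg (mul_nonneg (hq0 l) (hr i)) (mul_nonneg (hr i) (div_nonneg hn (he l j)))
      linarith
    · have hpos : 0 < r i * Complex.normSq (X i l j) :=
        lt_of_le_of_ne (mul_nonneg (hr i) hn) (Ne.symm h0)
      have hri : 0 < r i := lt_of_le_of_ne (hr i) fun h => h0 (by rw [← h, zero_mul])
      have hepos : 0 < e l j := by
        rw [← hc l j]
        exact lt_of_lt_of_le hpos (Finset.single_le_sum (f := fun i => r i * Complex.normSq (X i l j))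
          (fun k _ => mul_nonneg (hr k) (Complex.normSq_nonneg _)) (Finset.mem_univ i))
      have hqpos : 0 < q l := lt_of_lt_of_le hepos
        (Finset.single_le_sum (f := fun j => e l j) (fun k _ => he l k) (Finset.mem_univ j))
      have hlog : Real.log (q l) + Real.log (r i) - Real.log (e l j) = Real.log (q l * r i / e l j) := by
        rw [Real.log_div (by positivity) (by positivity), Real.log_mul (by positivity) (by positivity)]
      rw [hlog]
      have := Real.log_le_sub_one_of_pos (show 0 < q l * r i / e l j by positivity)
      calc _ ≤ r i * Complex.normSq (X i l j) * (q l * r i / e l j - 1) :=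
            mul_le_mul_of_nonneg_left this hpos.le
        _ = _ := by field_simp
  have hsum := Finset.sum_le_sum fun i (_ : i ∈ Finset.univ) =>
    Finset.sum_le_sum fun l (_ : l ∈ (Finset.univ : Finset L)) =>
      Finset.sum_le_sum fun j (_ : j ∈ (Finset.univ : Finset J)) => key i l j
  have hR : ∑ i, ∑ l, ∑ j, (q l * r i * (r i * (Complex.normSq (X i l j) / e l j))
      - r i * Complex.normSq (X i l j)) ≤ 0 := by
    have hb : ∀ i l, ∑ j, q l * r i * (r i * (Complex.normSq (X i l j) / e l j)) ≤ q l * r i := by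
      intro i l
      rw [← Finset.mul_sum, ← Finset.mul_sum]
      exact mul_le_of_le_one_right (mul_nonneg (hq0 l) (hr i))
        (bessel_aux (fun i j => X i l j) r (e l) hr (he l) (h2 l) i)
    have e1 : ∑ i, ∑ l, ∑ j, r i * Complex.normSq (X i l j) = 1 := by
      simp only [← Finset.mul_sum, h1, mul_one, hr1]
    have e2 : ∑ i, ∑ l, q l * r i = 1 := by
      simp only [← Finset.sum_mul, hetot, one_mul, hr1]
    simp only [Finset.sum_sub_distrib]
    rw [e1]
    have := Finset.sum_le_sum fun i (_ : i ∈ Finset.univ) =>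
      Finset.sum_le_sum fun l (_ : l ∈ (Finset.univ : Finset L)) => hb i l
    linarith
  have hL : ∑ i, ∑ l, ∑ j, r i * Complex.normSq (X i l j) *
      (Real.log (q l) + Real.log (r i) - Real.log (e l j))
      = -(∑ l, Real.negMulLog (q l)) - (∑ i, Real.negMulLog (r i))
        + ∑ l, ∑ j, Real.negMulLog (e l j) := by
    have a1 : ∑ i, ∑ l, ∑ j, r i * Complex.normSq (X i l j) * Real.log (q l)
        = -(∑ l, Real.negMulLog (q l)) := by
      rw [swap, ← Finset.sum_neg_distrib]
      refine Finset.sum_congr rfl fun l _ => ?_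
      simp only [← Finset.sum_mul, hc, Real.negMulLog]
      simp [hq]
    have a2 : ∑ i, ∑ l, ∑ j, r i * Complex.normSq (X i l j) * Real.log (r i)
        = -(∑ l, Real.negMulLog (r l)) := by
      rw [← Finset.sum_neg_distrib]
      refine Finset.sum_congr rfl fun l _ => ?_
      simp only [← Finset.sum_mul, ← Finset.mul_sum, h1, Real.negMulLog]
      simp
    have a3 : ∑ i, ∑ l, ∑ j, r i * Complex.normSq (X i l j) * Real.log (e l j)
        = -(∑ l, ∑ j, Real.negMulLog (e l j)) := by
      rw [swap, ← Finset.sum_neg_distrib]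
      refine Finset.sum_congr rfl fun l _ => ?_
      rw [← Finset.sum_neg_distrib]
      refine Finset.sum_congr rfl fun j _ => ?_
      simp only [← Finset.sum_mul, hc, Real.negMulLog]
      simp
    simp only [mul_sub, mul_add, Finset.sum_sub_distrib, Finset.sum_add_distrib, a1, a2, a3]
    ring
  linarith

/-- The embedding `|v⟩ ⊗ 1`. -/
def emb {n : Type*} (m : Type*) [DecidableEq m] (v : n → ℂ) : Matrix (n × m) m ℂ :=
  Matrix.of fun x y => v x.1 * (1 : Matrix m m ℂ) x.2 y

/-- The compressed block `(⟨v| ⊗ 1) ρ (|v⟩ ⊗ 1)`. -/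
def blk {n m : Type*} [Fintype n] [Fintype m] [DecidableEq m] (v : n → ℂ)
    (ρ : Matrix (n × m) (n × m) ℂ) : Matrix m m ℂ := (emb m v)ᴴ * ρ * emb m v

lemma emb_mul {n m k : Type*} [Fintype m] [DecidableEq m] (v : n → ℂ) (A : Matrix m k ℂ) (x : n × m) (y : k) :
    (emb m v * A) x y = v x.1 * A x.2 y := by
  simp [Matrix.mul_apply, emb, one_apply]

lemma emb_mul_mul {n m : Type*} [Fintype m] [DecidableEq m] (v : n → ℂ) (A : Matrix m m ℂ) :
    emb m v * A * (emb m v)ᴴ = proj v ⊗ₖ A := by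
  ext ⟨a, b⟩ ⟨a', b'⟩
  rw [Matrix.mul_apply]
  simp only [emb_mul, kronecker_apply, conjTranspose_apply]
  rw [Finset.sum_eq_single b' (by intro c _ hc; simp [emb, one_apply, hc.symm]) (by simp)]
  simp [emb, proj, vecMulVec_apply]
  ring

lemma pinch_eq {n m : Type*} [Fintype n] [Fintype m] [DecidableEq n] [DecidableEq m] (v : n → ℂ)
    (ρ : Matrix (n × m) (n × m) ℂ) :
    (proj v ⊗ₖ (1 : Matrix m m ℂ)) * ρ * (proj v ⊗ₖ (1 : Matrix m m ℂ)) = proj v ⊗ₖ blk v ρ := by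
  rw [← emb_mul_mul, ← emb_mul_mul, blk]
  simp only [Matrix.mul_one, Matrix.mul_assoc]

lemma pinch_ineq {n m : Type*} [Fintype n] [Fintype m] [DecidableEq n] [DecidableEq m] (g : n → n → ℂ)
    (hg : ∀ l m, star (g l) ⬝ᵥ g m = if l = m then 1 else 0)
    (ρ : Matrix (n × m) (n × m) ℂ) (hρ : ρ.PosSemidef) (hρ1 : ρ.trace = 1) :
    vN (∑ l, proj (g l) ⊗ₖ blk (g l) ρ) ≤
      ∑ l, Real.negMulLog ((blk (g l) ρ).trace.re) + vN ρ := by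
  have hps : ∀ l, (blk (g l) ρ).PosSemidef := fun l => hρ.conjTranspose_mul_mul_same _
  rw [vN_cq g hg _ fun l => (hps l).isHermitian]
  choose U e hU hU' hs hl hp ht using fun l => herm_spec (hps l).isHermitian
  obtain ⟨W, r, hW, hW', hsW, -, hr, htr⟩ := herm_spec hρ.isHermitian
  have hr1 : ∑ i, r i = 1 := by rw [hρ1] at htr; exact_mod_cast htr.symm
  have hv : ∀ l, vN (blk (g l) ρ) = ∑ j, Real.negMulLog (e l j) := by
    intro l
    conv_lhs => rw [hs l]
    rw [vN_iso _ _ (hU l)]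
  have hvr : vN ρ = ∑ j, Real.negMulLog (r j) := by
    conv_lhs => rw [hsW]
    rw [vN_iso _ _ hW]
  have hq : ∀ l, (blk (g l) ρ).trace.re = ∑ j, e l j := by
    intro l
    rw [ht l, ← Complex.ofReal_sum, Complex.ofReal_re]
  simp only [hv, hvr, hq]
  set V := (Matrix.of fun (x y : n × m) => g y.1 x.1 * U y.1 x.2 y.2) with hVdef
  have hV : Vᴴ * V = 1 := cq_iso g hg U hU
  have hV' : V * Vᴴ = 1 := mul_eq_one_comm.1 hV
  refine scalar_ineq (fun i l j => (Wᴴ * V) i (l, j)) r e (hr hρ) hr1 (fun l => hp l (hps l)) ?_ ?_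
  · intro i
    have h : (Wᴴ * V) * (Wᴴ * V)ᴴ = 1 := by
      rw [conjTranspose_mul, conjTranspose_conjTranspose]
      calc _ = Wᴴ * (V * Vᴴ) * W := by simp only [Matrix.mul_assoc]
        _ = 1 := by rw [hV', Matrix.mul_one, hW]
    have h := congrFun (congrFun h i) i
    rw [Matrix.mul_apply, one_apply_eq, Fintype.sum_prod_type] at h
    have h' : ((∑ l, ∑ j, Complex.normSq ((Wᴴ * V) i (l, j)) : ℝ) : ℂ) = 1 := by
      rw [← h, Complex.ofReal_sum]
      refine Finset.sum_congr rfl fun l _ => ?_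
      rw [Complex.ofReal_sum]
      refine Finset.sum_congr rfl fun j _ => ?_
      rw [← Complex.mul_conj]; rfl
    exact_mod_cast h'
  · intro l j j'
    have hVl : ∀ x j, V x (l, j) = (emb m (g l) * U l) x j := by
      intro x j; rw [emb_mul]; rfl
    have hX : ∀ i j, (Wᴴ * V) i (l, j) = (Wᴴ * (emb m (g l) * U l)) i j := by
      intro i j; rw [Matrix.mul_apply, Matrix.mul_apply]
      simp only [hVl]
    simp only [hX]
    have h3 : (Wᴴ * (emb m (g l) * U l))ᴴ * diagonal (fun i => (r i : ℂ)) *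
        (Wᴴ * (emb m (g l) * U l)) = diagonal (fun j => (e l j : ℂ)) := by
      calc _ = (U l)ᴴ * ((emb m (g l))ᴴ * (W * diagonal (fun i => (r i : ℂ)) * Wᴴ) * emb m (g l)) * U l := by
            simp only [conjTranspose_mul, conjTranspose_conjTranspose, Matrix.mul_assoc]
        _ = (U l)ᴴ * blk (g l) ρ * U l := by rw [← hsW]; rfl
        _ = ((U l)ᴴ * U l) * diagonal (fun j => (e l j : ℂ)) * ((U l)ᴴ * U l) := by
            conv_lhs => rw [hs l]
            simp only [Matrix.mul_assoc]
        _ = _ := by rw [hU l]; simp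
    have h4 := congrFun (congrFun h3 j) j'
    rw [Matrix.mul_apply, diagonal_apply] at h4
    rw [← h4]
    refine Finset.sum_congr rfl fun i _ => ?_
    rw [mul_diagonal, conjTranspose_apply]; ring

lemma proj_mul_proj {n : Type*} [Fintype n] [DecidableEq n] (g : n → n → ℂ)
    (hg : ∀ l m, star (g l) ⬝ᵥ g m = if l = m then 1 else 0) (l m : n) :
    proj (g l) * proj (g m) = if l = m then proj (g l) else 0 := by
  rw [proj, proj, vecMulVec_mul_vecMulVec, hg]
  split_ifs with h
  · subst h; simp
  · simp

lemma proj_herm {n : Type*} (v : n → ℂ) : (proj v)ᴴ = proj v := by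
  ext i j; simp [proj, vecMulVec_apply, mul_comm]

lemma proj_trace {n : Type*} [Fintype n] [DecidableEq n] (g : n → n → ℂ)
    (hg : ∀ l m, star (g l) ⬝ᵥ g m = if l = m then 1 else 0) (l : n) :
    (proj (g l)).trace = 1 := by
  rw [proj, trace_vecMulVec, dotProduct_comm, hg, if_pos rfl]

lemma rot_proj {n : Type*} [Fintype n] [DecidableEq n] (g : n → n → ℂ)
    (hg : ∀ l m, star (g l) ⬝ᵥ g m = if l = m then 1 else 0) (gv : n → ℝ) (r : ℝ) (l : n) :
    (Urot g gv r)ᴴ * proj (g l) * Urot g gv r = proj (g l) := by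
  have h1 : proj (g l) * Urot g gv r = Complex.exp (-(Complex.I) * (gv l) * r) • proj (g l) := by
    rw [Urot, Finset.mul_sum]
    simp only [Matrix.mul_smul, proj_mul_proj g hg]
    simp
  have h2 : (Urot g gv r)ᴴ * proj (g l) = star (Complex.exp (-(Complex.I) * (gv l) * r)) • proj (g l) := by
    have := congrArg conjTranspose h1
    rwa [conjTranspose_mul, conjTranspose_smul, proj_herm] at this
  rw [h2, Matrix.smul_mul, h1, smul_smul]
  have : star (Complex.exp (-(Complex.I) * (gv l) * r)) * Complex.exp (-(Complex.I) * (gv l) * r) = 1 := by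
    rw [Complex.star_def, ← Complex.exp_conj, ← Complex.exp_add]
    simp
  rw [this, one_smul]

lemma rot_unitary {n : Type*} [Fintype n] [DecidableEq n] (g : n → n → ℂ)
    (hg : ∀ l m, star (g l) ⬝ᵥ g m = if l = m then 1 else 0)
    (hgc : ∑ l, proj (g l) = (1 : Matrix n n ℂ)) (gv : n → ℝ) (r : ℝ) :
    (Urot g gv r)ᴴ * Urot g gv r = 1 := by
  have : (Urot g gv r)ᴴ * (∑ l, proj (g l)) * Urot g gv r = 1 := by
    rw [Finset.mul_sum, Finset.sum_mul]
    simp only [rot_proj g hg, hgc]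
  rwa [hgc, Matrix.mul_one] at this

lemma rot_trace {n m : Type*} [Fintype n] [Fintype m] [DecidableEq n] [DecidableEq m] (g : n → n → ℂ)
    (hg : ∀ l m, star (g l) ⬝ᵥ g m = if l = m then 1 else 0) (gv : n → ℝ) (r : ℝ) (l : n)
    (N : Matrix m m ℂ) (ρ : Matrix (n × m) (n × m) ℂ) :
    (((Urot g gv r ⊗ₖ (1 : Matrix m m ℂ)) * ρ * (Urot g gv r ⊗ₖ (1 : Matrix m m ℂ))ᴴ) *
      (proj (g l) ⊗ₖ N)).trace = (ρ * (proj (g l) ⊗ₖ N)).trace := by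
  set U := (Urot g gv r ⊗ₖ (1 : Matrix m m ℂ)) with hU
  calc _ = (U * (ρ * (Uᴴ * (proj (g l) ⊗ₖ N)))).trace := by simp only [Matrix.mul_assoc]
    _ = (ρ * (Uᴴ * (proj (g l) ⊗ₖ N) * U)).trace := by
        rw [trace_mul_comm]; simp only [Matrix.mul_assoc]
    _ = _ := by
        rw [hU, conjTranspose_kronecker, ← mul_kronecker_mul, ← mul_kronecker_mul, rot_proj g hg]
        simp

lemma pinch_trace {n m : Type*} [Fintype n] [Fintype m] [DecidableEq n] [DecidableEq m] (g : n → n → ℂ)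
    (hg : ∀ l m, star (g l) ⬝ᵥ g m = if l = m then 1 else 0) (l : n)
    (N : Matrix m m ℂ) (ρ : Matrix (n × m) (n × m) ℂ) :
    ((∑ l, proj (g l) ⊗ₖ blk (g l) ρ) * (proj (g l) ⊗ₖ N)).trace
      = (ρ * (proj (g l) ⊗ₖ N)).trace := by
  have : ∀ k, ((proj (g k) ⊗ₖ blk (g k) ρ) * (proj (g l) ⊗ₖ N)).trace
      = if k = l then (ρ * (proj (g l) ⊗ₖ N)).trace else 0 := by
    intro k
    rw [← pinch_eq]
    calc _ = ((proj (g k) ⊗ₖ (1 : Matrix m m ℂ)) * (ρ * ((proj (g k) ⊗ₖ (1 : Matrix m m ℂ)) *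
          (proj (g l) ⊗ₖ N)))).trace := by simp only [Matrix.mul_assoc]
      _ = (ρ * ((proj (g k) ⊗ₖ (1 : Matrix m m ℂ)) *
          (proj (g l) ⊗ₖ N) * (proj (g k) ⊗ₖ (1 : Matrix m m ℂ)))).trace := by
          rw [trace_mul_comm]; simp only [Matrix.mul_assoc]
      _ = _ := by
          rw [← mul_kronecker_mul, ← mul_kronecker_mul, proj_mul_proj g hg]
          split_ifs with h
          · subst h; rw [proj_mul_proj g hg]; simp
          · simp
  rw [Finset.sum_mul, trace_sum]
  simp only [this]
  simp

lemma relent_eq {n m k : Type*} [Fintype n] [Fintype m] [Fintype k] [DecidableEq n] [DecidableEq m]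
    (g : n → n → ℂ)
    (hg : ∀ l m, star (g l) ⬝ᵥ g m = if l = m then 1 else 0) (gv : n → ℝ)
    (rv p : k → ℝ) (hps : ∑ i, p i = 1) (ρ : Matrix (n × m) (n × m) ℂ) (hρ : ρ.PosSemidef) :
    relent (∑ i, (p i : ℂ) • ((Urot g gv (rv i) ⊗ₖ (1 : Matrix m m ℂ)) * ρ *
        (Urot g gv (rv i) ⊗ₖ (1 : Matrix m m ℂ))ᴴ)) (∑ l, proj (g l) ⊗ₖ blk (g l) ρ)
      = vN (∑ l, proj (g l) ⊗ₖ blk (g l) ρ)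
        - vN (∑ i, (p i : ℂ) • ((Urot g gv (rv i) ⊗ₖ (1 : Matrix m m ℂ)) * ρ *
        (Urot g gv (rv i) ⊗ₖ (1 : Matrix m m ℂ))ᴴ)) := by
  have hps' : ∀ l, (blk (g l) ρ).PosSemidef := fun l => hρ.conjTranspose_mul_mul_same _
  have hm := mlog_cq g hg (fun l => blk (g l) ρ) fun l => (hps' l).isHermitian
  rw [relent, vN, vN, Matrix.mul_sub, trace_sub, Complex.sub_re]
  suffices h : ((∑ i, (p i : ℂ) • ((Urot g gv (rv i) ⊗ₖ (1 : Matrix m m ℂ)) * ρ *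
        (Urot g gv (rv i) ⊗ₖ (1 : Matrix m m ℂ))ᴴ)) * mlog (∑ l, proj (g l) ⊗ₖ blk (g l) ρ)).trace
      = ((∑ l, proj (g l) ⊗ₖ blk (g l) ρ) * mlog (∑ l, proj (g l) ⊗ₖ blk (g l) ρ)).trace by
    rw [h]; ring
  rw [hm, Finset.mul_sum, Finset.mul_sum, trace_sum, trace_sum]
  refine Finset.sum_congr rfl fun l _ => ?_
  rw [pinch_trace g hg, Finset.sum_mul, trace_sum]
  simp only [Matrix.smul_mul, trace_smul, rot_trace g hg]
  rw [← Finset.sum_smul, ← Complex.ofReal_sum, hps]; simp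

lemma blk_apply {n m : Type*} [Fintype n] [Fintype m] [DecidableEq m] (v : n → ℂ)
    (ρ : Matrix (n × m) (n × m) ℂ) (b b' : m) :
    blk v ρ b b' = ∑ a, ∑ a', proj v a' a * ρ (a, b) (a', b') := by
  rw [blk, Matrix.mul_assoc, Matrix.mul_apply, Fintype.sum_prod_type]
  refine Finset.sum_congr rfl fun a _ => ?_
  rw [Finset.sum_eq_single b (by intro c _ hc; simp [emb, one_apply, hc]) (by simp), Matrix.mul_apply,
    Fintype.sum_prod_type, Finset.mul_sum]
  refine Finset.sum_congr rfl fun a' _ => ?_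
  rw [Finset.sum_eq_single b' (by intro c _ hc; simp [emb, one_apply, hc]) (by simp)]
  simp [emb, proj, vecMulVec_apply]; ring

/-- Partial trace over the first factor. -/
def ptL {n m : Type*} [Fintype n] (ρ : Matrix (n × m) (n × m) ℂ) : Matrix m m ℂ :=
  Matrix.of fun b b' => ∑ a, ρ (a, b) (a, b')

lemma ptL_trace {n m : Type*} [Fintype n] [Fintype m] (ρ : Matrix (n × m) (n × m) ℂ) :
    (ptL ρ).trace = ρ.trace := by
  simp only [Matrix.trace, Fintype.sum_prod_type, ptL, Matrix.diag, Matrix.of_apply]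
  exact Finset.sum_comm

lemma ptL_herm {n m : Type*} [Fintype n] [Fintype m] {ρ : Matrix (n × m) (n × m) ℂ} (h : ρ.IsHermitian) :
    (ptL ρ).IsHermitian := by
  ext b b'
  simp only [conjTranspose_apply, ptL, Matrix.of_apply, star_sum]
  exact Finset.sum_congr rfl fun a _ => h.apply _ _

lemma sum_blk {n m : Type*} [Fintype n] [Fintype m] [DecidableEq n] [DecidableEq m] (g : n → n → ℂ)
    (hgc : ∑ l, proj (g l) = (1 : Matrix n n ℂ)) (ρ : Matrix (n × m) (n × m) ℂ) :
    ∑ l, blk (g l) ρ = ptL ρ := by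
  ext b b'
  rw [Matrix.sum_apply]
  simp only [blk_apply, ptL, Matrix.of_apply]
  rw [Finset.sum_comm]
  refine Finset.sum_congr rfl fun a _ => ?_
  rw [Finset.sum_comm]
  simp only [← Finset.sum_mul, ← Matrix.sum_apply, hgc]
  simp [one_apply]

section Red

set_option linter.unusedSectionVars false

variable {iR iA iB1 iB2 : Type*} [Fintype iR] [Fintype iA] [Fintype iB1] [Fintype iB2]
  [DecidableEq iR] [DecidableEq iA] [DecidableEq iB1] [DecidableEq iB2]

lemma kappa3_eq (p : iR → ℝ) (rb : iR → iR → ℂ) (rv : iR → ℝ) (g : iA → iA → ℂ) (gv : iA → ℝ)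
    (A : Matrix (iA × iB1) (iA × iB1) ℂ) (B : Matrix iB2 iB2 ℂ) :
    kappa3 p rb rv g gv (A ⊗ₖ B) = ∑ k, (p k : ℂ) • (proj (rb k) ⊗ₖ
      (((Urot g gv (rv k) ⊗ₖ (1 : Matrix iB1 iB1 ℂ)) * A *
        (Urot g gv (rv k) ⊗ₖ (1 : Matrix iB1 iB1 ℂ))ᴴ) ⊗ₖ B)) := by
  rw [kappa3]
  refine Finset.sum_congr rfl fun k _ => ?_
  rw [UA3, conjTranspose_kronecker, ← mul_kronecker_mul, ← mul_kronecker_mul]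
  simp

lemma omega3_eq (g : iA → iA → ℂ)
    (A : Matrix (iA × iB1) (iA × iB1) ℂ) (B : Matrix iB2 iB2 ℂ) :
    omega3 g (A ⊗ₖ B) = (∑ l, proj (g l) ⊗ₖ blk (g l) A) ⊗ₖ B := by
  have : ∀ l, ((proj (g l) ⊗ₖ (1 : Matrix iB1 iB1 ℂ)) ⊗ₖ (1 : Matrix iB2 iB2 ℂ)) * (A ⊗ₖ B) *
       ((proj (g l) ⊗ₖ (1 : Matrix iB1 iB1 ℂ)) ⊗ₖ (1 : Matrix iB2 iB2 ℂ))
       = (proj (g l) ⊗ₖ blk (g l) A) ⊗ₖ B := by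
    intro l
    rw [← mul_kronecker_mul, ← mul_kronecker_mul, pinch_eq]
    simp
  rw [omega3]
  simp only [this]
  ext ⟨x, u⟩ ⟨y, v⟩
  simp only [Matrix.sum_apply, kronecker_apply, Finset.sum_mul]

lemma redRAB1_eq (c : iR → ℂ) (P : iR → Matrix iR iR ℂ) (K : iR → Matrix (iA × iB1) (iA × iB1) ℂ)
    (B : Matrix iB2 iB2 ℂ) (hB : B.trace = 1) :
    redRAB1 (∑ k, c k • (P k ⊗ₖ (K k ⊗ₖ B))) = ∑ k, P k ⊗ₖ (c k • K k) := by
  ext ⟨x, u⟩ ⟨y, v⟩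
  simp only [redRAB1, Matrix.of_apply, Matrix.sum_apply, Matrix.smul_apply, kronecker_apply, smul_eq_mul]
  rw [Finset.sum_comm]
  refine Finset.sum_congr rfl fun k _ => ?_
  simp only [← Finset.mul_sum]
  have : ∑ i, B i i = 1 := hB
  rw [this]; simp; ring

lemma redAB1four_eq (c : iR → ℂ) (P : iR → Matrix iR iR ℂ) (hP : ∀ k, (P k).trace = 1)
    (K : iR → Matrix (iA × iB1) (iA × iB1) ℂ)
    (B : Matrix iB2 iB2 ℂ) (hB : B.trace = 1) :
    redAB1four (∑ k, c k • (P k ⊗ₖ (K k ⊗ₖ B))) = ∑ k, c k • K k := by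
  ext x y
  simp only [redAB1four, Matrix.of_apply, Matrix.sum_apply, Matrix.smul_apply, kronecker_apply, smul_eq_mul]
  have : ∑ i, B i i = 1 := hB
  have hP' : ∀ k, ∑ i, P k i i = 1 := hP
  have h1 : ∀ z : iR, ∑ m, ∑ k, c k * (P k z z * (K k x y * B m m)) = ∑ k, c k * (P k z z * K k x y) := by
    intro z
    rw [Finset.sum_comm]
    simp only [← Finset.mul_sum, this, mul_one]
  simp only [h1]
  rw [Finset.sum_comm]
  simp only [← Finset.mul_sum, ← Finset.sum_mul, hP', one_mul]

lemma redRfour_eq (c : iR → ℂ) (P : iR → Matrix iR iR ℂ)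
    (K : iR → Matrix (iA × iB1) (iA × iB1) ℂ) (hK : ∀ k, (K k).trace = 1)
    (B : Matrix iB2 iB2 ℂ) (hB : B.trace = 1) :
    redRfour (∑ k, c k • (P k ⊗ₖ (K k ⊗ₖ B))) = ∑ k, c k • P k := by
  ext i j
  simp only [redRfour, Matrix.of_apply, Matrix.sum_apply, Matrix.smul_apply,
    kronecker_apply (P _), smul_eq_mul]
  rw [Finset.sum_comm]
  refine Finset.sum_congr rfl fun k _ => ?_
  simp only [← Finset.mul_sum]
  have : ∑ x, (K k ⊗ₖ B) x x = 1 := by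
    have := trace_kronecker (K k) B
    rw [hK, hB, one_mul] at this
    exact this
  rw [this, mul_one]

lemma redAB1_eq (A : Matrix (iA × iB1) (iA × iB1) ℂ) (B : Matrix iB2 iB2 ℂ) (hB : B.trace = 1) :
    redAB1 (A ⊗ₖ B) = A := by
  ext x y
  simp only [redAB1, Matrix.of_apply, kronecker_apply, ← Finset.mul_sum]
  have : ∑ i, B i i = 1 := hB
  rw [this, mul_one]

lemma redB2_eq (A : Matrix (iA × iB1) (iA × iB1) ℂ) (B : Matrix iB2 iB2 ℂ) (hA : A.trace = 1) :
    redB2 (A ⊗ₖ B) = B := by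
  ext x y
  simp only [redB2, Matrix.of_apply, kronecker_apply, ← Finset.sum_mul]
  have : ∑ i, A i i = 1 := hA
  rw [this, one_mul]

lemma redB1_eq (A : Matrix (iA × iB1) (iA × iB1) ℂ) (B : Matrix iB2 iB2 ℂ) (hB : B.trace = 1) :
    redB1 (A ⊗ₖ B) = ptL A := by
  ext x y
  simp only [redB1, ptL, Matrix.of_apply, kronecker_apply, ← Finset.mul_sum]
  have : ∑ i, B i i = 1 := hB
  simp only [this, mul_one]

lemma redB1B2_eq (A : Matrix (iA × iB1) (iA × iB1) ℂ) (B : Matrix iB2 iB2 ℂ) :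
    redB1B2 (A ⊗ₖ B) = ptL A ⊗ₖ B := by
  ext ⟨x, u⟩ ⟨y, v⟩
  simp only [redB1B2, ptL, Matrix.of_apply, kronecker_apply, ← Finset.sum_mul]

lemma redA3_eq (P : iA → Matrix iA iA ℂ) (T : iA → Matrix iB1 iB1 ℂ)
    (B : Matrix iB2 iB2 ℂ) (hB : B.trace = 1) :
    redA3 ((∑ l, P l ⊗ₖ T l) ⊗ₖ B) = ∑ l, (T l).trace • P l := by
  ext x y
  have : ∑ i, B i i = 1 := hB
  simp only [redA3, Matrix.of_apply, kronecker_apply, ← Finset.mul_sum, this, mul_one, Matrix.sum_apply]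
  rw [Finset.sum_comm]
  refine Finset.sum_congr rfl fun l _ => ?_
  simp [← Finset.mul_sum, Matrix.trace, mul_comm]

lemma redAB2_eq (P : iA → Matrix iA iA ℂ) (T : iA → Matrix iB1 iB1 ℂ)
    (B : Matrix iB2 iB2 ℂ) :
    redAB2 ((∑ l, P l ⊗ₖ T l) ⊗ₖ B) = (∑ l, (T l).trace • P l) ⊗ₖ B := by
  ext ⟨x, u⟩ ⟨y, v⟩
  simp only [redAB2, Matrix.of_apply, kronecker_apply, ← Finset.sum_mul, Matrix.sum_apply]
  congr 1
  rw [Finset.sum_comm]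
  refine Finset.sum_congr rfl fun l _ => ?_
  simp [← Finset.mul_sum, Matrix.trace, mul_comm]

lemma ptL_cq (P : iA → Matrix iA iA ℂ) (hP : ∀ k, (P k).trace = 1) (T : iA → Matrix iB1 iB1 ℂ) :
    ptL (∑ l, P l ⊗ₖ T l) = ∑ l, T l := by
  ext x y
  have hP' : ∀ k, ∑ i, P k i i = 1 := hP
  simp only [ptL, Matrix.of_apply, Matrix.sum_apply, kronecker_apply]
  rw [Finset.sum_comm]
  simp only [← Finset.sum_mul, hP', one_mul]

end Red

/-- **Saturation of the tripartite bound for product states** `ρ_{AB₁B₂} = ρ_{AB₁} ⊗ ρ_{B₂}`: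
`S(R|AB₁)_κ + S(A|B₂)_ω = S(R)_κ + D(κ_{AB₁}‖ω_{AB₁})
  + max{0, I(A:B₁)_ω − I(B₁:B₂)_ρ + S(A|B₁B₂)_ρ}`. -/
theorem tripartite_entropic_uncertainty_saturation_product
    {iR iA iB1 iB2 : Type*} [Fintype iR] [Fintype iA] [Fintype iB1] [Fintype iB2]
    [DecidableEq iR] [DecidableEq iA] [DecidableEq iB1] [DecidableEq iB2]
    (ρ : Matrix ((iA × iB1) × iB2) ((iA × iB1) × iB2) ℂ)
    (hρ : ρ.PosSemidef) (hρtr : ρ.trace = 1)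
    (ρAB1 : Matrix (iA × iB1) (iA × iB1) ℂ) (ρB2 : Matrix iB2 iB2 ℂ)
    (hρAB1 : ρAB1.PosSemidef) (hρAB1tr : ρAB1.trace = 1)
    (hρB2 : ρB2.PosSemidef) (hρB2tr : ρB2.trace = 1)
    (hprod : ρ = ρAB1 ⊗ₖ ρB2)
    (g : iA → iA → ℂ) (gv : iA → ℝ)
    (hg : ∀ l m, star (g l) ⬝ᵥ g m = if l = m then 1 else 0)
    (hgc : ∑ l, proj (g l) = (1 : Matrix iA iA ℂ))
    (rb : iR → iR → ℂ)
    (hrb : ∀ k m, star (rb k) ⬝ᵥ rb m = if k = m then 1 else 0)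
    (hrbc : ∑ k, proj (rb k) = (1 : Matrix iR iR ℂ))
    (rv : iR → ℝ) (p : iR → ℝ) (hp : ∀ k, 0 ≤ p k) (hps : ∑ k, p k = 1) :
    (vN (redRAB1 (kappa3 p rb rv g gv ρ)) - vN (redAB1four (kappa3 p rb rv g gv ρ)))
      + (vN (redAB2 (omega3 g ρ)) - vN (redB2 (omega3 g ρ)))
    = vN (redRfour (kappa3 p rb rv g gv ρ))
      + relent (redAB1four (kappa3 p rb rv g gv ρ)) (redAB1 (omega3 g ρ))
      + max 0
        ((vN (redA3 (omega3 g ρ)) + vN (redB1 (omega3 g ρ)) - vN (redAB1 (omega3 g ρ)))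
          - (vN (redB1 ρ) + vN (redB2 ρ) - vN (redB1B2 ρ))
          + (vN ρ - vN (redB1B2 ρ))) := by
  subst hprod
  have tU : ∀ k, ((Urot g gv (rv k) ⊗ₖ (1 : Matrix iB1 iB1 ℂ)))ᴴ *
      (Urot g gv (rv k) ⊗ₖ (1 : Matrix iB1 iB1 ℂ)) = 1 := by
    intro k
    rw [conjTranspose_kronecker, ← mul_kronecker_mul, rot_unitary g hg hgc]
    simp
  have tK : ∀ k, ((Urot g gv (rv k) ⊗ₖ (1 : Matrix iB1 iB1 ℂ)) * ρAB1 *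
        (Urot g gv (rv k) ⊗ₖ (1 : Matrix iB1 iB1 ℂ))ᴴ).trace = 1 := by
    intro k
    rw [trace_mul_comm, ← Matrix.mul_assoc, tU, Matrix.one_mul, hρAB1tr]
  have tP := proj_trace rb hrb
  have tPg := proj_trace g hg
  have hps' : ∀ l, (blk (g l) ρAB1).PosSemidef := fun l => hρAB1.conjTranspose_mul_mul_same _
  have hpt : ptL (∑ l, proj (g l) ⊗ₖ blk (g l) ρAB1) = ptL ρAB1 := by
    rw [ptL_cq _ tPg, sum_blk g hgc]
  have tω : (∑ l, proj (g l) ⊗ₖ blk (g l) ρAB1).trace = 1 := by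
    rw [← ptL_trace, hpt, ptL_trace, hρAB1tr]
  have hq : ∀ l, (blk (g l) ρAB1).trace = (((blk (g l) ρAB1).trace.re : ℝ) : ℂ) := by
    intro l
    obtain ⟨U, e, -, -, -, -, -, ht⟩ := herm_spec (hps' l).isHermitian
    rw [ht, ← Complex.ofReal_sum, Complex.ofReal_re]
  have hA : ∑ l, (blk (g l) ρAB1).trace • proj (g l)
      = ∑ l, (((blk (g l) ρAB1).trace.re : ℝ) : ℂ) • proj (g l) :=
    Finset.sum_congr rfl fun l _ => by rw [← hq l]
  have vA := vN_classical g hg fun l => (blk (g l) ρAB1).trace.re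
  have tA : (∑ l, (((blk (g l) ρAB1).trace.re : ℝ) : ℂ) • proj (g l)).trace = 1 := by
    rw [← hA, trace_sum]
    simp only [trace_smul, tPg, smul_eq_mul, mul_one]
    rw [← trace_sum, sum_blk g hgc, ptL_trace, hρAB1tr]
  have hAh : (∑ l, (((blk (g l) ρAB1).trace.re : ℝ) : ℂ) • proj (g l)).IsHermitian := by
    rw [IsHermitian, conjTranspose_sum]
    refine Finset.sum_congr rfl fun l _ => ?_
    rw [conjTranspose_smul, proj_herm]
    simp
  have hRAB : vN (∑ k, proj (rb k) ⊗ₖ ((p k : ℂ) • ((Urot g gv (rv k) ⊗ₖ (1 : Matrix iB1 iB1 ℂ)) * ρAB1 *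
        (Urot g gv (rv k) ⊗ₖ (1 : Matrix iB1 iB1 ℂ))ᴴ))) = ∑ k, Real.negMulLog (p k) + vN ρAB1 := by
    obtain ⟨W, e, hW, -, hs, -, -, ht⟩ := herm_spec hρAB1.isHermitian
    have he : ∑ i, e i = 1 := by rw [hρAB1tr] at ht; exact_mod_cast ht.symm
    have hdec : ∀ k, ((p k : ℂ) • ((Urot g gv (rv k) ⊗ₖ (1 : Matrix iB1 iB1 ℂ)) * ρAB1 *
        (Urot g gv (rv k) ⊗ₖ (1 : Matrix iB1 iB1 ℂ))ᴴ))
        = ((Urot g gv (rv k) ⊗ₖ (1 : Matrix iB1 iB1 ℂ)) * W) *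
          diagonal (fun i => ((p k * e i : ℝ) : ℂ)) *
          ((Urot g gv (rv k) ⊗ₖ (1 : Matrix iB1 iB1 ℂ)) * W)ᴴ := by
      intro k
      have : diagonal (fun i => ((p k * e i : ℝ) : ℂ)) = (p k : ℂ) • diagonal (fun i => (e i : ℂ)) := by
        ext i j
        simp [diagonal_apply]
      rw [this]
      conv_lhs => rw [hs]
      simp only [conjTranspose_mul, Matrix.mul_assoc, Matrix.mul_smul, Matrix.smul_mul]
    have hiso : ∀ k, ((Urot g gv (rv k) ⊗ₖ (1 : Matrix iB1 iB1 ℂ)) * W)ᴴ *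
        ((Urot g gv (rv k) ⊗ₖ (1 : Matrix iB1 iB1 ℂ)) * W) = 1 := by
      intro k
      rw [conjTranspose_mul]
      calc _ = Wᴴ * ((Urot g gv (rv k) ⊗ₖ (1 : Matrix iB1 iB1 ℂ))ᴴ *
            (Urot g gv (rv k) ⊗ₖ (1 : Matrix iB1 iB1 ℂ))) * W := by simp only [Matrix.mul_assoc]
        _ = 1 := by rw [tU, Matrix.mul_one, hW]
    rw [vN_cq rb hrb]
    · have : vN ρAB1 = ∑ i, Real.negMulLog (e i) := by
        conv_lhs => rw [hs]
        rw [vN_iso _ _ hW]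
      rw [this, ← negMulLog_prod_sum p e hps he]
      refine Finset.sum_congr rfl fun k _ => ?_
      rw [hdec, vN_iso _ _ (hiso k)]
    · intro k
      have h1 : ((Urot g gv (rv k) ⊗ₖ (1 : Matrix iB1 iB1 ℂ)) * ρAB1 *
        (Urot g gv (rv k) ⊗ₖ (1 : Matrix iB1 iB1 ℂ))ᴴ).IsHermitian :=
        (hρAB1.mul_mul_conjTranspose_same _).isHermitian
      rw [IsHermitian, conjTranspose_smul, h1.eq]
      simp
  have hineq := pinch_ineq g hg ρAB1 hρAB1 hρAB1tr
  rw [kappa3_eq, omega3_eq, redRAB1_eq _ _ _ _ hρB2tr, redAB1four_eq _ _ tP _ _ hρB2tr,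
    redRfour_eq _ _ _ tK _ hρB2tr, redAB2_eq, redA3_eq _ _ _ hρB2tr, redB2_eq _ _ tω,
    redB2_eq _ _ hρAB1tr, redB1_eq _ _ hρB2tr, redB1_eq _ _ hρB2tr, redB1B2_eq, redAB1_eq _ _ hρB2tr,
    hpt, hA, vN_kron hAh hρB2.isHermitian tA hρB2tr,
    vN_kron hρAB1.isHermitian hρB2.isHermitian hρAB1tr hρB2tr,
    vN_kron (ptL_herm hρAB1.isHermitian) hρB2.isHermitian (by rw [ptL_trace, hρAB1tr]) hρB2tr,
    hRAB, relent_eq g hg gv rv p hps ρAB1 hρAB1, vN_classical rb hrb p, vA]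
  rw [max_eq_right (by linarith)]
  ring
end
end

section
/- If ρ_{AB} = ρ_A ⊗ ρ_B is a product state, then the bipartite uncertainty bound is saturated: S(R|AB)_κ + S(A|B)_ω = S(R)_κ + D(κ_A ‖ ω_A) + S(A|B)_ρ. -/
open scoped Kronecker Classical ComplexOrder
open Matrix

noncomputable section

section Bipartite

variable {iR iA iB : Type*} [Fintype iR] [Fintype iA] [Fintype iB]
  [DecidableEq iR] [DecidableEq iA] [DecidableEq iB]

/-- `κ_{RAB} = Σ_k p_k |r_k⟩⟨r_k| ⊗ (e^{-iGr_k}⊗I) ρ (e^{iGr_k}⊗I)`. -/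
def kappa2 (p : iR → ℝ) (rb : iR → iR → ℂ) (rv : iR → ℝ) (g : iA → iA → ℂ) (gv : iA → ℝ)
    (ρ : Matrix (iA × iB) (iA × iB) ℂ) :
    Matrix (iR × (iA × iB)) (iR × (iA × iB)) ℂ :=
  ∑ k, (p k : ℂ) •
    (proj (rb k) ⊗ₖ
      ((Urot g gv (rv k) ⊗ₖ (1 : Matrix iB iB ℂ)) * ρ *
        (Urot g gv (rv k) ⊗ₖ (1 : Matrix iB iB ℂ))ᴴ))

/-- `ω_{AB} = Σ_l (|g_l⟩⟨g_l|⊗I) ρ (|g_l⟩⟨g_l|⊗I)`. -/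
def omega2 (g : iA → iA → ℂ) (ρ : Matrix (iA × iB) (iA × iB) ℂ) :
    Matrix (iA × iB) (iA × iB) ℂ :=
  ∑ l, ((proj (g l) ⊗ₖ (1 : Matrix iB iB ℂ)) * ρ * (proj (g l) ⊗ₖ (1 : Matrix iB iB ℂ)))

/-- Reduced state on `AB` of a state on `RAB`. -/
def redABthree (τ : Matrix (iR × (iA × iB)) (iR × (iA × iB)) ℂ) :
    Matrix (iA × iB) (iA × iB) ℂ :=
  Matrix.of fun x y => ∑ k : iR, τ (k, x) (k, y)

/-- Reduced state on `R` of a state on `RAB`. -/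
def redRthree (τ : Matrix (iR × (iA × iB)) (iR × (iA × iB)) ℂ) :
    Matrix iR iR ℂ :=
  Matrix.of fun i j => ∑ x : iA × iB, τ (i, x) (j, x)

/-- Reduced state on `A` of a state on `RAB`. -/
def redAthree (τ : Matrix (iR × (iA × iB)) (iR × (iA × iB)) ℂ) :
    Matrix iA iA ℂ :=
  Matrix.of fun i j => ∑ k : iR, ∑ b : iB, τ (k, (i, b)) (k, (j, b))

/-- Reduced state on `A` of a state on `AB`. -/
def redA2 (σ : Matrix (iA × iB) (iA × iB) ℂ) : Matrix iA iA ℂ :=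
  Matrix.of fun i j => ∑ b : iB, σ (i, b) (j, b)

/-- Reduced state on `B` of a state on `AB`. -/
def redB2' (σ : Matrix (iA × iB) (iA × iB) ℂ) : Matrix iB iB ℂ :=
  Matrix.of fun i j => ∑ a : iA, σ (a, i) (a, j)

end Bipartite

/-- Matrix whose columns are the given vectors. -/
def colMat {α : Type*} (g : α → α → ℂ) : Matrix α α ℂ := Matrix.of fun i l => g l i

lemma colMat_unitary {α : Type*} [Fintype α] [DecidableEq α] (g : α → α → ℂ)
    (hg : ∀ l m, star (g l) ⬝ᵥ g m = if l = m then 1 else 0) :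
    (colMat g)ᴴ * colMat g = 1 := by
  ext l m
  rw [Matrix.one_apply, ← hg l m]
  simp [colMat, Matrix.mul_apply, dotProduct]

lemma sum_smul_proj {α : Type*} [Fintype α] [DecidableEq α] (g : α → α → ℂ) (c : α → ℂ) :
    ∑ l, c l • proj (g l) = colMat g * Matrix.diagonal c * (colMat g)ᴴ := by
  ext i j
  rw [Matrix.mul_apply]
  simp only [Matrix.sum_apply, Matrix.smul_apply, proj, Matrix.vecMulVec_apply,
    Matrix.mul_diagonal, colMat, Matrix.conjTranspose_apply, Matrix.of_apply, Pi.star_apply,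
    smul_eq_mul]
  exact Finset.sum_congr rfl fun l _ => by ring

lemma mlog_eq {n : Type*} [Fintype n] [DecidableEq n] (ρ U : Matrix n n ℂ) (d : n → ℝ)
    (hU : Uᴴ * U = 1) (h : ρ = U * Matrix.diagonal (fun i => (d i : ℂ)) * Uᴴ) :
    mlog ρ = U * Matrix.diagonal (fun i => (Real.log (d i) : ℂ)) * Uᴴ := by
  have hU' : U * Uᴴ = 1 := mul_eq_one_comm.mp hU
  have hH : ρ.IsHermitian := by
    rw [h, Matrix.IsHermitian]
    simp only [Matrix.conjTranspose_mul, Matrix.conjTranspose_conjTranspose,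
      Matrix.diagonal_conjTranspose, Matrix.mul_assoc]
    congr 3
    ext i j
    simp
  rw [mlog, dif_pos hH]
  set V : Matrix n n ℂ := (hH.eigenvectorUnitary : Matrix n n ℂ) with hVdef
  set e := hH.eigenvalues with he
  have hV : Vᴴ * V = 1 := by
    have := Unitary.coe_star_mul_self hH.eigenvectorUnitary
    simpa [Matrix.star_eq_conjTranspose] using this
  have hV' : V * Vᴴ = 1 := mul_eq_one_comm.mp hV
  have hs : ρ = V * Matrix.diagonal (fun i => (e i : ℂ)) * Vᴴ := by
    have := hH.spectral_theorem
    simpa [Unitary.conjStarAlgAut_apply, Matrix.star_eq_conjTranspose, Function.comp_def]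
      using this
  have key : Matrix.diagonal (fun i => (d i : ℂ)) * (Uᴴ * V)
      = (Uᴴ * V) * Matrix.diagonal (fun i => (e i : ℂ)) := by
    calc _ = (Uᴴ * U) * Matrix.diagonal (fun i => (d i : ℂ)) * (Uᴴ * V) := by rw [hU, one_mul]
      _ = Uᴴ * (U * Matrix.diagonal (fun i => (d i : ℂ)) * Uᴴ) * V := by
        simp only [Matrix.mul_assoc]
      _ = Uᴴ * (V * Matrix.diagonal (fun i => (e i : ℂ)) * Vᴴ) * V := by rw [← h, ← hs]
      _ = (Uᴴ * V) * Matrix.diagonal (fun i => (e i : ℂ)) * (Vᴴ * V) := by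
        simp only [Matrix.mul_assoc]
      _ = _ := by rw [hV, mul_one]
  have key2 : Matrix.diagonal (fun i => (Real.log (d i) : ℂ)) * (Uᴴ * V)
      = (Uᴴ * V) * Matrix.diagonal (fun i => (Real.log (e i) : ℂ)) := by
    ext i j
    have := congrFun (congrFun key i) j
    rw [Matrix.diagonal_mul, Matrix.mul_diagonal] at this ⊢
    by_cases hz : (Uᴴ * V) i j = 0
    · simp [hz]
    · rw [mul_comm] at this
      have h2 := mul_left_cancel₀ hz this
      have h3 : d i = e j := by exact_mod_cast h2
      rw [h3, mul_comm]
  calc V * Matrix.diagonal (fun i => (Real.log (e i) : ℂ)) * Vᴴ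
      = (U * Uᴴ) * V * Matrix.diagonal (fun i => (Real.log (e i) : ℂ)) * Vᴴ := by
        rw [hU', one_mul]
    _ = U * ((Uᴴ * V) * Matrix.diagonal (fun i => (Real.log (e i) : ℂ))) * Vᴴ := by
        simp only [Matrix.mul_assoc]
    _ = U * Matrix.diagonal (fun i => (Real.log (d i) : ℂ)) * Uᴴ * (V * Vᴴ) := by
        rw [← key2]; simp only [Matrix.mul_assoc]
    _ = _ := by rw [hV', mul_one]

lemma trace_mul_mlog {n : Type*} [Fintype n] [DecidableEq n] (τ ρ U : Matrix n n ℂ) (d : n → ℝ)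
    (hU : Uᴴ * U = 1) (h : ρ = U * Matrix.diagonal (fun i => (d i : ℂ)) * Uᴴ) :
    Matrix.trace (τ * mlog ρ) = ∑ i, (Uᴴ * τ * U) i i * (Real.log (d i) : ℂ) := by
  rw [mlog_eq ρ U d hU h, ← Matrix.mul_assoc, Matrix.trace_mul_comm, ← Matrix.mul_assoc,
    ← Matrix.mul_assoc]
  simp [Matrix.trace, Matrix.mul_diagonal]

lemma conj_diag {n : Type*} [Fintype n] [DecidableEq n] (ρ U D : Matrix n n ℂ)
    (hU : Uᴴ * U = 1) (h : ρ = U * D * Uᴴ) : Uᴴ * ρ * U = D := by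
  rw [h]
  calc _ = (Uᴴ * U) * D * (Uᴴ * U) := by simp only [Matrix.mul_assoc]
    _ = D := by rw [hU, one_mul, mul_one]

lemma vN_eq {n : Type*} [Fintype n] [DecidableEq n] (ρ U : Matrix n n ℂ) (d : n → ℝ)
    (hU : Uᴴ * U = 1) (h : ρ = U * Matrix.diagonal (fun i => (d i : ℂ)) * Uᴴ) :
    vN ρ = ∑ i, Real.negMulLog (d i) := by
  rw [vN, trace_mul_mlog ρ ρ U d hU h, conj_diag ρ U _ hU h]
  simp only [Matrix.diagonal_apply_eq, ← Complex.ofReal_mul, ← Complex.ofReal_sum,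
    Complex.ofReal_re, Real.negMulLog, ← Finset.sum_neg_distrib, neg_mul]

lemma exists_diag {n : Type*} [Fintype n] [DecidableEq n] (ρ : Matrix n n ℂ)
    (hH : ρ.IsHermitian) (ht : ρ.trace = 1) : ∃ (U : Matrix n n ℂ) (d : n → ℝ),
      Uᴴ * U = 1 ∧ ρ = U * Matrix.diagonal (fun i => (d i : ℂ)) * Uᴴ ∧ ∑ i, d i = 1 := by
  have hV : (hH.eigenvectorUnitary : Matrix n n ℂ)ᴴ * hH.eigenvectorUnitary = 1 := by
    have := Unitary.coe_star_mul_self hH.eigenvectorUnitary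
    simpa [Matrix.star_eq_conjTranspose] using this
  have hs : ρ = hH.eigenvectorUnitary * Matrix.diagonal (fun i => (hH.eigenvalues i : ℂ))
      * (hH.eigenvectorUnitary : Matrix n n ℂ)ᴴ := by
    have := hH.spectral_theorem
    simpa [Unitary.conjStarAlgAut_apply, Matrix.star_eq_conjTranspose, Function.comp_def]
      using this
  refine ⟨hH.eigenvectorUnitary, hH.eigenvalues, hV, hs, ?_⟩
  have := hH.trace_eq_sum_eigenvalues
  rw [ht] at this
  have h2 : ((1 : ℝ) : ℂ) = ((∑ i, hH.eigenvalues i : ℝ) : ℂ) := by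
    push_cast; exact this
  exact (Complex.ofReal_injective h2).symm

lemma sum_negMulLog_mul {n m : Type*} [Fintype n] [Fintype m] (a : n → ℝ) (b : m → ℝ)
    (ha : ∑ i, a i = 1) (hb : ∑ i, b i = 1) :
    ∑ x : n × m, Real.negMulLog (a x.1 * b x.2)
      = ∑ i, Real.negMulLog (a i) + ∑ i, Real.negMulLog (b i) := by
  rw [Fintype.sum_prod_type]
  simp only [Real.negMulLog_mul, Finset.sum_add_distrib, ← Finset.sum_mul, ← Finset.mul_sum,
    ha, hb, one_mul]

lemma vN_kron_s4 {n m : Type*} [Fintype n] [DecidableEq n] [Fintype m] [DecidableEq m]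
    (ρ : Matrix n n ℂ) (σ : Matrix m m ℂ) (hρ : ρ.IsHermitian) (hσ : σ.IsHermitian)
    (tρ : ρ.trace = 1) (tσ : σ.trace = 1) : vN (ρ ⊗ₖ σ) = vN ρ + vN σ := by
  obtain ⟨U, a, hU, ha, sa⟩ := exists_diag ρ hρ tρ
  obtain ⟨V, b, hV, hb, sb⟩ := exists_diag σ hσ tσ
  rw [vN_eq ρ U a hU ha, vN_eq σ V b hV hb, ← sum_negMulLog_mul a b sa sb]
  apply vN_eq _ (U ⊗ₖ V)
  · rw [Matrix.conjTranspose_kronecker, ← Matrix.mul_kronecker_mul, hU, hV,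
      Matrix.one_kronecker_one]
  · conv_lhs => rw [ha, hb]
    rw [Matrix.mul_kronecker_mul, Matrix.mul_kronecker_mul, Matrix.conjTranspose_kronecker,
      Matrix.diagonal_kronecker_diagonal]
    simp

lemma vN_cq_s4 {n m : Type*} [Fintype n] [DecidableEq n] [Fintype m] [DecidableEq m]
    (p : n → ℝ) (hps : ∑ k, p k = 1) (rb : n → n → ℂ)
    (hrb : ∀ k m, star (rb k) ⬝ᵥ rb m = if k = m then 1 else 0)
    (T : n → Matrix m m ℂ) (hT : ∀ k, (T k)ᴴ * T k = 1)
    (ρ : Matrix m m ℂ) (hρ : ρ.IsHermitian) (tρ : ρ.trace = 1) :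
    vN (∑ k, (p k : ℂ) • (proj (rb k) ⊗ₖ (T k * ρ * (T k)ᴴ)))
      = ∑ k, Real.negMulLog (p k) + vN ρ := by
  obtain ⟨W, d, hW, hd, sd⟩ := exists_diag ρ hρ tρ
  rw [vN_eq ρ W d hW hd, ← sum_negMulLog_mul p d hps sd]
  have hM : ∀ k, (T k * W)ᴴ * (T k * W) = 1 := fun k => by
    rw [Matrix.conjTranspose_mul, Matrix.mul_assoc, ← Matrix.mul_assoc (T k)ᴴ, hT, one_mul, hW]
  have hc : ∀ k, T k * ρ * (T k)ᴴ
      = (T k * W) * Matrix.diagonal (fun i => (d i : ℂ)) * (T k * W)ᴴ := fun k => by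
    rw [Matrix.conjTranspose_mul, hd]; simp only [Matrix.mul_assoc]
  let Z : Matrix (n × m) (n × m) ℂ := Matrix.of fun x y => rb y.1 x.1 * (T y.1 * W) x.2 y.2
  apply vN_eq _ Z
  · ext ⟨k, x⟩ ⟨l, y⟩
    have h1 : (Zᴴ * Z) (k, x) (l, y)
        = (star (rb k) ⬝ᵥ rb l) * ((T k * W)ᴴ * (T l * W)) x y := by
      rw [Matrix.mul_apply, Fintype.sum_prod_type, Matrix.mul_apply, dotProduct,
        Finset.sum_mul_sum]
      refine Finset.sum_congr rfl fun i _ => Finset.sum_congr rfl fun j _ => ?_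
      simp only [Matrix.conjTranspose_apply, Z, Matrix.of_apply, star_mul', Pi.star_apply]
      ring
    rw [h1, hrb]
    by_cases hkl : k = l
    · subst hkl
      rw [hM]
      simp [Matrix.one_apply]
    · simp [Matrix.one_apply, hkl]
  · ext ⟨k, x⟩ ⟨l, y⟩
    rw [Matrix.mul_apply, Fintype.sum_prod_type, Matrix.sum_apply]
    refine Finset.sum_congr rfl fun i _ => ?_
    rw [hc, Matrix.smul_apply, Matrix.kroneckerMap_apply, Matrix.mul_apply, smul_eq_mul,
      Finset.mul_sum, Finset.mul_sum]
    refine Finset.sum_congr rfl fun j _ => ?_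
    simp only [Matrix.mul_diagonal, Matrix.conjTranspose_apply, Z, Matrix.of_apply, star_mul',
      proj, Matrix.vecMulVec_apply, Pi.star_apply, Complex.ofReal_mul]
    ring

lemma trace_conj_unitary {n : Type*} [Fintype n] [DecidableEq n] (U ρ : Matrix n n ℂ)
    (hU : Uᴴ * U = 1) : (U * ρ * Uᴴ).trace = ρ.trace := by
  rw [Matrix.trace_mul_comm, ← Matrix.mul_assoc, hU, one_mul]

lemma diag_phase_unitary {n : Type*} [Fintype n] [DecidableEq n] (gv : n → ℝ) (r : ℝ) :
    (Matrix.diagonal (fun l => Complex.exp (-(Complex.I) * (gv l) * r)))ᴴ *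
      Matrix.diagonal (fun l => Complex.exp (-(Complex.I) * (gv l) * r)) = 1 := by
  rw [Matrix.diagonal_conjTranspose, Matrix.diagonal_mul_diagonal, ← Matrix.diagonal_one]
  congr 1
  ext l
  simp only [Pi.star_apply, Complex.star_def, ← Complex.exp_conj, ← Complex.exp_add]
  simp

lemma Urot_unitary {n : Type*} [Fintype n] [DecidableEq n] (g : n → n → ℂ) (gv : n → ℝ)
    (hg : ∀ l m, star (g l) ⬝ᵥ g m = if l = m then 1 else 0) (r : ℝ) :
    (Urot g gv r)ᴴ * Urot g gv r = 1 := by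
  have hP := colMat_unitary g hg
  have hP' : colMat g * (colMat g)ᴴ = 1 := mul_eq_one_comm.mp hP
  rw [Urot, sum_smul_proj]
  have hD := diag_phase_unitary gv r
  set D := Matrix.diagonal (fun l => Complex.exp (-(Complex.I) * (gv l) * r))
  set P := colMat g
  calc (P * D * Pᴴ)ᴴ * (P * D * Pᴴ) = P * (Dᴴ * ((Pᴴ * P) * D)) * Pᴴ := by
        simp only [Matrix.conjTranspose_mul, Matrix.conjTranspose_conjTranspose, Matrix.mul_assoc]
    _ = 1 := by rw [hP, one_mul, hD, mul_one, hP']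

/-- Diagonal entries in the eigenbasis are unaffected by the rotation. -/
lemma Urot_diag {n : Type*} [Fintype n] [DecidableEq n] (g : n → n → ℂ) (gv : n → ℝ)
    (hg : ∀ l m, star (g l) ⬝ᵥ g m = if l = m then 1 else 0) (r : ℝ) (ρ : Matrix n n ℂ) (l : n) :
    ((colMat g)ᴴ * (Urot g gv r * ρ * (Urot g gv r)ᴴ) * colMat g) l l
      = ((colMat g)ᴴ * ρ * colMat g) l l := by
  have hP := colMat_unitary g hg
  have hD := congrFun (congrFun (diag_phase_unitary gv r) l) l
  rw [Urot, sum_smul_proj]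
  rw [Matrix.diagonal_conjTranspose, Matrix.diagonal_mul, Matrix.diagonal_apply_eq,
    Matrix.one_apply_eq] at hD
  set c := (fun l => Complex.exp (-(Complex.I) * (gv l) * r)) with hc
  set P := colMat g
  have : Pᴴ * (P * Matrix.diagonal c * Pᴴ * ρ * (P * Matrix.diagonal c * Pᴴ)ᴴ) * P
      = Matrix.diagonal c * (Pᴴ * ρ * P) * Matrix.diagonal (star c) := by
    calc _ = (Pᴴ * P) * (Matrix.diagonal c * (Pᴴ * ρ * P) * (Matrix.diagonal c)ᴴ) * (Pᴴ * P) := by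
          simp only [Matrix.conjTranspose_mul, Matrix.conjTranspose_conjTranspose,
            Matrix.mul_assoc]
      _ = _ := by rw [hP, one_mul, mul_one, Matrix.diagonal_conjTranspose]
  rw [this, Matrix.mul_diagonal, Matrix.diagonal_mul]
  rw [mul_right_comm, mul_comm (c l), hD, one_mul]

/-- The rotated average of a state on `A`. -/
def kapA {iR iA : Type*} [Fintype iR] [Fintype iA] (p rv : iR → ℝ)
    (g : iA → iA → ℂ) (gv : iA → ℝ) (ρA : Matrix iA iA ℂ) : Matrix iA iA ℂ :=
  ∑ k, (p k : ℂ) • (Urot g gv (rv k) * ρA * (Urot g gv (rv k))ᴴ)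

/-- The dephased state on `A`. -/
def omA {iA : Type*} [Fintype iA] (g : iA → iA → ℂ) (ρA : Matrix iA iA ℂ) : Matrix iA iA ℂ :=
  ∑ l, proj (g l) * ρA * proj (g l)

lemma omA_eq {iA : Type*} [Fintype iA] [DecidableEq iA] (g : iA → iA → ℂ) (ρA : Matrix iA iA ℂ)
    (hρ : ρA.IsHermitian) :
    omA g ρA = colMat g *
      Matrix.diagonal (fun l => ((((colMat g)ᴴ * ρA * colMat g) l l).re : ℂ)) * (colMat g)ᴴ := by
  rw [omA, ← sum_smul_proj]
  refine Finset.sum_congr rfl fun l _ => ?_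
  have hre : ((((colMat g)ᴴ * ρA * colMat g) l l).re : ℂ) = ((colMat g)ᴴ * ρA * colMat g) l l := by
    have hh : ((colMat g)ᴴ * ρA * colMat g).IsHermitian :=
      Matrix.isHermitian_conjTranspose_mul_mul _ hρ
    exact hh.coe_re_apply_self l
  have hd : ((colMat g)ᴴ * ρA * colMat g) l l = star (g l) ⬝ᵥ (ρA *ᵥ g l) := by
    rw [Matrix.mul_assoc]
    simp [Matrix.mul_apply, colMat, dotProduct, Matrix.mulVec]
  rw [hre, hd, proj, Matrix.vecMulVec_mul, Matrix.vecMulVec_mul_vecMulVec,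
    Matrix.dotProduct_mulVec, Matrix.vecMulVec_smul]

/-- **Saturation of the bipartite bound for product states** `ρ_{AB} = ρ_A ⊗ ρ_B`:
`S(R|AB)_κ + S(A|B)_ω = S(R)_κ + D(κ_A‖ω_A) + S(A|B)_ρ`. -/
theorem bipartite_entropic_uncertainty_saturation_product
    {iR iA iB : Type*} [Fintype iR] [Fintype iA] [Fintype iB]
    [DecidableEq iR] [DecidableEq iA] [DecidableEq iB]
    (ρ : Matrix (iA × iB) (iA × iB) ℂ)
    (hρ : ρ.PosSemidef) (hρtr : ρ.trace = 1)
    (ρA : Matrix iA iA ℂ) (ρB : Matrix iB iB ℂ)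
    (hρA : ρA.PosSemidef) (hρAtr : ρA.trace = 1)
    (hρB : ρB.PosSemidef) (hρBtr : ρB.trace = 1)
    (hprod : ρ = ρA ⊗ₖ ρB)
    (g : iA → iA → ℂ) (gv : iA → ℝ)
    (hg : ∀ l m, star (g l) ⬝ᵥ g m = if l = m then 1 else 0)
    (hgc : ∑ l, proj (g l) = (1 : Matrix iA iA ℂ))
    (rb : iR → iR → ℂ)
    (hrb : ∀ k m, star (rb k) ⬝ᵥ rb m = if k = m then 1 else 0)
    (hrbc : ∑ k, proj (rb k) = (1 : Matrix iR iR ℂ))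
    (rv : iR → ℝ) (p : iR → ℝ) (hp : ∀ k, 0 ≤ p k) (hps : ∑ k, p k = 1) :
    (vN (kappa2 p rb rv g gv ρ) - vN (redABthree (kappa2 p rb rv g gv ρ)))
      + (vN (omega2 g ρ) - vN (redB2' (omega2 g ρ)))
    = vN (redRthree (kappa2 p rb rv g gv ρ))
      + relent (redAthree (kappa2 p rb rv g gv ρ)) (redA2 (omega2 g ρ))
      + (vN ρ - vN (redB2' ρ)) := by
  have hUu := Urot_unitary g gv hg
  have hP := colMat_unitary g hg
  have hU1 : ∀ r, (Urot g gv r ⊗ₖ (1 : Matrix iB iB ℂ))ᴴ * (Urot g gv r ⊗ₖ (1 : Matrix iB iB ℂ))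
      = 1 := fun r => by
    rw [Matrix.conjTranspose_kronecker, ← Matrix.mul_kronecker_mul, hUu,
      Matrix.conjTranspose_one, one_mul, Matrix.one_kronecker_one]
  have hconj : ∀ r, (Urot g gv r ⊗ₖ (1 : Matrix iB iB ℂ)) * ρ *
      (Urot g gv r ⊗ₖ (1 : Matrix iB iB ℂ))ᴴ
      = (Urot g gv r * ρA * (Urot g gv r)ᴴ) ⊗ₖ ρB := fun r => by
    rw [hprod, Matrix.conjTranspose_kronecker, ← Matrix.mul_kronecker_mul,
      ← Matrix.mul_kronecker_mul, Matrix.conjTranspose_one, one_mul, mul_one]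
  have htrp : ∀ k, ∑ i, proj (rb k) i i = 1 := fun k => by
    have := hrb k k
    rw [if_pos rfl] at this
    rw [← this]
    simp [proj, Matrix.vecMulVec_apply, dotProduct, mul_comm]
  have htrB : ∑ b, ρB b b = 1 := hρBtr
  have hpsC : ∑ k, (p k : ℂ) = 1 := by exact_mod_cast hps
  -- entropy of the joint state
  have e1 : vN (kappa2 p rb rv g gv ρ) = ∑ k, Real.negMulLog (p k) + vN ρ :=
    vN_cq_s4 p hps rb hrb (fun k => Urot g gv (rv k) ⊗ₖ (1 : Matrix iB iB ℂ)) (fun k => hU1 _) ρ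
      hρ.1 hρtr
  have e2 : redABthree (kappa2 p rb rv g gv ρ) = kapA p rv g gv ρA ⊗ₖ ρB := by
    ext ⟨a, b⟩ ⟨a', b'⟩
    simp only [redABthree, kappa2, hconj, kapA, Matrix.of_apply, Matrix.sum_apply,
      Matrix.smul_apply, Matrix.kroneckerMap_apply, smul_eq_mul]
    rw [Finset.sum_comm, Finset.sum_mul]
    refine Finset.sum_congr rfl fun k _ => ?_
    rw [← Finset.mul_sum, ← Finset.sum_mul, htrp]
    ring
  have e3 : redAthree (kappa2 p rb rv g gv ρ) = kapA p rv g gv ρA := by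
    have : redAthree (kappa2 p rb rv g gv ρ) = redA2 (redABthree (kappa2 p rb rv g gv ρ)) := by
      ext a a'
      simp only [redAthree, redA2, redABthree, Matrix.of_apply]
      rw [Finset.sum_comm]
    rw [this, e2]
    ext a a'
    simp only [redA2, Matrix.of_apply, Matrix.kroneckerMap_apply]
    rw [← Finset.mul_sum, htrB, mul_one]
  have htrU : ∀ r, (Urot g gv r * ρA * (Urot g gv r)ᴴ).trace = 1 := fun r => by
    rw [trace_conj_unitary _ _ (hUu r), hρAtr]
  have e4 : vN (redRthree (kappa2 p rb rv g gv ρ)) = ∑ k, Real.negMulLog (p k) := by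
    apply vN_eq _ (colMat rb) _ (colMat_unitary rb hrb)
    rw [← sum_smul_proj]
    ext i j
    simp only [redRthree, kappa2, hconj, Matrix.of_apply, Matrix.sum_apply, Matrix.smul_apply,
      smul_eq_mul]
    rw [Finset.sum_comm]
    refine Finset.sum_congr rfl fun k _ => ?_
    have ht : ∑ x, ((Urot g gv (rv k) * ρA * (Urot g gv (rv k))ᴴ) ⊗ₖ ρB) x x = 1 := by
      have := Matrix.trace_kronecker (Urot g gv (rv k) * ρA * (Urot g gv (rv k))ᴴ) ρB
      rw [htrU, hρBtr, mul_one] at this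
      exact this
    rw [← Finset.mul_sum]
    simp only [Matrix.kroneckerMap_apply (f := (· * ·)) (A := proj (rb k))]
    rw [← Finset.mul_sum, ht, mul_one]
  have hκH : (kapA p rv g gv ρA).IsHermitian := by
    rw [Matrix.IsHermitian, kapA, Matrix.conjTranspose_sum]
    refine Finset.sum_congr rfl fun k _ => ?_
    rw [Matrix.conjTranspose_smul, (Matrix.isHermitian_mul_mul_conjTranspose _ hρA.1).eq]
    simp
  have hκt : (kapA p rv g gv ρA).trace = 1 := by
    rw [kapA, Matrix.trace_sum]
    simp only [Matrix.trace_smul, htrU, smul_eq_mul, mul_one, hpsC]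
  have e5 : omega2 g ρ = omA g ρA ⊗ₖ ρB := by
    have : ∀ l, (proj (g l) ⊗ₖ (1 : Matrix iB iB ℂ)) * ρ * (proj (g l) ⊗ₖ (1 : Matrix iB iB ℂ))
        = (proj (g l) * ρA * proj (g l)) ⊗ₖ ρB := fun l => by
      rw [hprod, ← Matrix.mul_kronecker_mul, ← Matrix.mul_kronecker_mul, one_mul, mul_one]
    simp only [omega2, this, omA]
    ext ⟨a, b⟩ ⟨a', b'⟩
    simp only [Matrix.sum_apply, Matrix.kroneckerMap_apply, Finset.sum_mul]
  set w : iA → ℝ := fun l => (((colMat g)ᴴ * ρA * colMat g) l l).re with hw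
  have hwC : ∀ l, (w l : ℂ) = ((colMat g)ᴴ * ρA * colMat g) l l := fun l =>
    (Matrix.isHermitian_conjTranspose_mul_mul (colMat g) hρA.1).coe_re_apply_self l
  have hω := omA_eq g ρA hρA.1
  have hωH : (omA g ρA).IsHermitian := by
    rw [hω]
    apply Matrix.isHermitian_mul_mul_conjTranspose
    rw [Matrix.IsHermitian, Matrix.diagonal_conjTranspose]
    congr 1
    ext l
    simp
  have hωt : (omA g ρA).trace = 1 := by
    rw [hω, trace_conj_unitary _ _ hP, Matrix.trace_diagonal]
    have : ∑ l, (w l : ℂ) = ((colMat g)ᴴ * ρA * colMat g).trace := by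
      simp only [hwC]; rfl
    rw [this, Matrix.trace_mul_comm, ← Matrix.mul_assoc, mul_eq_one_comm.mp hP, one_mul, hρAtr]
  have e6 : redA2 (omega2 g ρ) = omA g ρA := by
    rw [e5]
    ext a a'
    simp only [redA2, Matrix.of_apply, Matrix.kroneckerMap_apply]
    rw [← Finset.mul_sum, htrB, mul_one]
  have hB : ∀ X : Matrix iA iA ℂ, X.trace = 1 → redB2' (X ⊗ₖ ρB) = ρB := fun X hX => by
    ext b b'
    simp only [redB2', Matrix.of_apply, Matrix.kroneckerMap_apply]
    rw [← Finset.sum_mul]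
    have : ∑ a, X a a = 1 := hX
    rw [this, one_mul]
  have e7 : relent (kapA p rv g gv ρA) (omA g ρA) = - vN (kapA p rv g gv ρA) + vN (omA g ρA) := by
    have hdiag : ∀ l, ((colMat g)ᴴ * kapA p rv g gv ρA * colMat g) l l = (w l : ℂ) := fun l => by
      rw [kapA, Finset.mul_sum, Finset.sum_mul, Matrix.sum_apply]
      simp only [Matrix.mul_smul, Matrix.smul_mul, Matrix.smul_apply, Urot_diag g gv hg, ← hwC]
      rw [← Finset.sum_smul, hpsC, one_smul]
    have h1 : (Matrix.trace (kapA p rv g gv ρA * mlog (omA g ρA)))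
        = Matrix.trace (omA g ρA * mlog (omA g ρA)) := by
      rw [trace_mul_mlog _ _ _ w hP hω, trace_mul_mlog _ _ _ w hP hω, conj_diag _ _ _ hP hω]
      refine Finset.sum_congr rfl fun l _ => ?_
      rw [hdiag, Matrix.diagonal_apply_eq]
    rw [relent, mul_sub, Matrix.trace_sub, h1, Complex.sub_re, vN, vN]
    ring
  rw [e1, e2, e3, e4, e6, e5, e7, hB _ hωt, hprod, hB _ hρAtr,
    vN_kron_s4 _ _ hκH hρB.1 hκt hρBtr, vN_kron_s4 _ _ hωH hρB.1 hωt hρBtr]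
  ring
end
end
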